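/- For every constant a > 0 there exist constants c, η > 0 such that: for all N ≥ 1 and all K with aK² > N and K ≤ m_{∞,a}(N), one has ψ_{N,a}(K)/K ≤ c (K/m_{∞,a}(N))^η, where ψ_{N,a}(K) := sup{K' : a·π_1(K')·K² ≥ N} and m_{∞,a}(N) := sup{m : a·π_1(m)·m² ≤ N}. (The paper's Lemma is the case a = c_θ.) -/

import Mathlib

open MeasureTheory ProbabilityTheory Filter

noncomputable section

namespace FrozenPercolation

/-- Sites of the triangular lattice, coordinatized by `ℤ × ℤ`. -/
abbrev Site : Type := ℤ × ℤ

/-- The embedding `(x, y) ↦ x + y·e^{iπ/3}` of the sites into `ℂ`. -/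
def embed (v : Site) : ℂ :=
  (v.1 : ℂ) + (v.2 : ℂ) * Complex.exp (Complex.I * (Real.pi / 3))

/-- The triangular lattice: two sites are adjacent iff their embeddings are at
Euclidean distance `1`. -/
def Tri : SimpleGraph Site where
  Adj u v := dist (embed u) (embed v) = 1
  symm := ⟨fun u v h => by
    show dist (embed v) (embed u) = 1
    rwa [dist_comm]⟩
  loopless := ⟨fun u h => by
    have : dist (embed u) (embed u) = 1 := h
    rw [dist_self] at this; norm_num at this⟩

/-- The subgraph of `G` induced by the vertices of `S` (viewed as a graph on all sites). -/
def restrictGraph (G : SimpleGraph Site) (S : Set Site) : SimpleGraph Site where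
  Adj u v := G.Adj u v ∧ u ∈ S ∧ v ∈ S
  symm := ⟨fun u v h => ⟨G.adj_symm h.1, h.2.2, h.2.1⟩⟩
  loopless := ⟨fun u h => G.loopless.irrefl u h.1⟩

/-- In the standard coupling by i.i.d. uniform labels, `v` is `p`-black iff its
label is at most `p`. -/
def Black (p : ℝ) (ω : Site → ℝ) (v : Site) : Prop := ω v ≤ p

/-- The graph on the `p`-black sites. -/
def blackGraph (p : ℝ) (ω : Site → ℝ) : SimpleGraph Site :=
  restrictGraph Tri {v | Black p ω v}

/-- `u ⟷ v`: `u` and `v` are joined by a path of `p`-black sites. -/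
def Conn (p : ℝ) (ω : Site → ℝ) (u v : Site) : Prop :=
  Black p ω u ∧ Black p ω v ∧ (blackGraph p ω).Reachable u v

/-- `u` and `v` are joined by a `p`-black path staying inside `S`. -/
def ConnIn (p : ℝ) (ω : Site → ℝ) (S : Set Site) (u v : Site) : Prop :=
  u ∈ S ∧ v ∈ S ∧ Black p ω u ∧ Black p ω v ∧
    (restrictGraph (blackGraph p ω) S).Reachable u v

/-- The `p`-black cluster of `v`. -/
def cluster (p : ℝ) (ω : Site → ℝ) (v : Site) : Set Site := {u | Conn p ω v u}

/-- `v ⟷ ∞` : `v` lies in an infinite `p`-black cluster. -/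
def ConnInf (p : ℝ) (ω : Site → ℝ) (v : Site) : Prop :=
  Black p ω v ∧ (cluster p ω v).Infinite

/-- The infinite `p`-black cluster. -/
def Cinf (p : ℝ) (ω : Site → ℝ) : Set Site := {v | ConnInf p ω v}

/-- Inner (vertex) boundary of `S`. -/
def innerBdry (S : Set Site) : Set Site := {v | v ∈ S ∧ ∃ u, u ∉ S ∧ Tri.Adj v u}

/-- Outer (vertex) boundary of `S`. -/
def outBdry (S : Set Site) : Set Site := {v | v ∉ S ∧ ∃ u, u ∈ S ∧ Tri.Adj v u}

/-- The box `B_r` : sites embedded in `[-r, r]²`. -/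
def box (r : ℝ) : Set Site := {v | |(embed v).re| ≤ r ∧ |(embed v).im| ≤ r}

/-- The box `B_r(z)`. -/
def boxAt (r : ℝ) (z : ℂ) : Set Site :=
  {v | |(embed v - z).re| ≤ r ∧ |(embed v - z).im| ≤ r}

/-- The probability (as a real number) of an event under `μ`. -/
def prob (μ : Measure (Site → ℝ)) (E : Set (Site → ℝ)) : ℝ := (μ E).toReal

/-- `μ` is the standard coupling of all the percolation parameters: under `μ` the
labels `(ω v)_{v ∈ Site}` are i.i.d., uniformly distributed on `[0, 1]`. -/
def IsUniformCoupling (μ : Measure (Site → ℝ)) : Prop :=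
  IsProbabilityMeasure μ ∧
  iIndepFun (m := fun _ : Site => (inferInstance : MeasurableSpace ℝ)) (fun v ω => ω v) μ ∧
  ∀ v : Site, μ.map (fun ω => ω v) = volume.restrict (Set.Icc (0 : ℝ) 1)

/-- The critical point of site percolation on the triangular lattice. -/
def pc : ℝ := 1 / 2

/-- `θ(p)`: the density of the infinite `p`-black cluster. -/
def theta (μ : Measure (Site → ℝ)) (p : ℝ) : ℝ := prob μ {ω | ConnInf p ω 0}

/-- Sites embedded in the rectangle `[x₁, x₂] × [y₁, y₂]`. -/
def rectSites (x₁ x₂ y₁ y₂ : ℝ) : Set Site :=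
  {v | (embed v).re ∈ Set.Icc x₁ x₂ ∧ (embed v).im ∈ Set.Icc y₁ y₂}

/-- Horizontal `p`-black crossing of the rectangle `[x₁, x₂] × [y₁, y₂]`
(a `p`-black path in the rectangle joining its two vertical sides). -/
def HCross (p : ℝ) (ω : Site → ℝ) (x₁ x₂ y₁ y₂ : ℝ) : Prop :=
  ∃ u v, ConnIn p ω (rectSites x₁ x₂ y₁ y₂) u v ∧
    (embed u).re ≤ x₁ + 1 ∧ x₂ - 1 ≤ (embed v).re

/-- The characteristic length, as a natural number. -/
def Lnat (μ : Measure (Site → ℝ)) (p : ℝ) : ℕ :=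
  if p < pc then sSup {n : ℕ | (1 : ℝ) / 100 ≤ prob μ {ω | HCross p ω 0 n 0 (2 * n)}}
  else sSup {n : ℕ | (1 : ℝ) / 100 ≤ prob μ {ω | HCross (1 - p) ω 0 n 0 (2 * n)}}

/-- The characteristic length `L(p)`. -/
def charL (μ : Measure (Site → ℝ)) (p : ℝ) : ℝ := (Lnat μ p : ℝ)

/-- `v` is adjacent to the set `S`. -/
def AdjSet (v : Site) (S : Set Site) : Prop := ∃ w ∈ S, Tri.Adj v w

/-- One-arm event: a `p`-black path in `B_n`, from `B_m` (or a neighbour of it)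
to the inner boundary of `B_n`. -/
def ArmEvent (p m n : ℝ) : Set (Site → ℝ) :=
  {ω | ∃ u v, ConnIn p ω (box n) u v ∧ (u ∈ box m ∨ AdjSet u (box m)) ∧
        v ∈ innerBdry (box n)}

/-- `π₁(m, n)`: the critical one-arm probability from scale `m` to scale `n`. -/
def pi1 (μ : Measure (Site → ℝ)) (m n : ℝ) : ℝ := prob μ (ArmEvent pc m n)

/-- `π₁(n) = π₁(0, n)`: the critical one-arm probability from the origin to `∂B_n`. -/
def pi1n (μ : Measure (Site → ℝ)) (n : ℝ) : ℝ := pi1 μ 0 n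

/-- The set removed when defining the hole of the origin: the infinite cluster
together with its outer boundary. -/
def holeCoRegion (p : ℝ) (ω : Site → ℝ) : Set Site := Cinf p ω ∪ outBdry (Cinf p ω)

/-- The hole `H(p)` of the origin in the infinite `p`-black cluster. -/
def hole (p : ℝ) (ω : Site → ℝ) : Set Site :=
  {u | (0 : Site) ∉ holeCoRegion p ω ∧ u ∉ holeCoRegion p ω ∧
       (restrictGraph Tri (holeCoRegion p ω)ᶜ).Reachable 0 u}

/-- `S` induces a connected subgraph of the triangular lattice. -/
def ConnectedOn (S : Set Site) : Prop :=
  ∀ u ∈ S, ∀ v ∈ S, (restrictGraph Tri S).Reachable u v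

/-- A finite simply connected domain: both `Λ` and its complement induce
connected subgraphs. -/
def SCDomain (Λ : Set Site) : Prop :=
  Λ.Finite ∧ ConnectedOn Λ ∧ ConnectedOn Λᶜ

/-- `𝒞_Λ(p)`: the `p`-black vertices joined to the inner boundary of `Λ`
by `p`-black paths inside `Λ`. -/
def domCluster (p : ℝ) (ω : Site → ℝ) (Λ : Set Site) : Set Site :=
  {v | ∃ w, w ∈ innerBdry Λ ∧ ConnIn p ω Λ v w}

/-- The set removed when defining `H^{(Λ)}(p)`. -/
def removedIn (p : ℝ) (ω : Site → ℝ) (Λ : Set Site) : Set Site :=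
  innerBdry Λ ∪ domCluster p ω Λ ∪ outBdry (domCluster p ω Λ)

/-- `H^{(Λ)}(p)`: the hole of the origin seen from the domain `Λ`. -/
def holeIn (p : ℝ) (ω : Site → ℝ) (Λ : Set Site) : Set Site :=
  {u | (0 : Site) ∉ removedIn p ω Λ ∧ u ∉ removedIn p ω Λ ∧
       (restrictGraph Tri (removedIn p ω Λ)ᶜ).Reachable 0 u}

/-- The `p`-black cluster of `v` inside `S`. -/
def clusterIn (p : ℝ) (ω : Site → ℝ) (S : Set Site) (v : Site) : Set Site :=
  {u | ConnIn p ω S v u}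

/-- The volume of a largest `p`-black cluster of `S`. -/
def maxClusterVol (p : ℝ) (ω : Site → ℝ) (S : Set Site) : ℕ :=
  sSup {k : ℕ | ∃ v ∈ S, k = (clusterIn p ω S v).ncard}

/-- The volume of a largest `p`-black cluster of `S` contained in the infinite
cluster. -/
def maxClusterVolInf (p : ℝ) (ω : Site → ℝ) (S : Set Site) : ℕ :=
  sSup {k : ℕ | ∃ v ∈ S, ConnInf p ω v ∧ k = (clusterIn p ω S v).ncard}

/-- The volume of a largest `p`-black cluster of `S` not contained in the infinite
cluster. -/
def maxClusterVolFin (p : ℝ) (ω : Site → ℝ) (S : Set Site) : ℕ :=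
  sSup {k : ℕ | ∃ v ∈ S, Black p ω v ∧ ¬ ConnInf p ω v ∧ k = (clusterIn p ω S v).ncard}

/-- `𝒱_n`: the number of sites of `B_n` joined to `∂B_{2n}` by a `p`-black path. -/
def VolConn (p n : ℝ) (ω : Site → ℝ) : ℕ :=
  ({v | v ∈ box n ∧ ∃ w, w ∈ innerBdry (box (2 * n)) ∧ Conn p ω v w}).ncard

/-- `ψ_{N,a}(K) = sup {K' : a·π₁(K')·K² ≥ N}`. -/
def psiN (μ : Measure (Site → ℝ)) (a : ℝ) (N : ℕ) (K : ℝ) : ℝ :=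
  sSup {K' : ℝ | (N : ℝ) ≤ a * pi1n μ K' * K ^ 2}

/-- `m_{∞,a}(N) = sup {m : a·π₁(m)·m² ≤ N}`. -/
def mInfty (μ : Measure (Site → ℝ)) (a : ℝ) (N : ℕ) : ℝ :=
  sSup {m : ℝ | a * pi1n μ m * m ^ 2 ≤ (N : ℝ)}


/-! ### Combinatorics of the triangular lattice -/

/-- Adjacency in lattice coordinates. -/
def HA (u v : Site) : Prop :=
  (v.1 = u.1 + 1 ∧ v.2 = u.2) ∨ (v.1 = u.1 - 1 ∧ v.2 = u.2) ∨
  (v.1 = u.1 ∧ v.2 = u.2 + 1) ∨ (v.1 = u.1 ∧ v.2 = u.2 - 1) ∨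
  (v.1 = u.1 + 1 ∧ v.2 = u.2 - 1) ∨ (v.1 = u.1 - 1 ∧ v.2 = u.2 + 1)

theorem HA.symm {u v : Site} (h : HA u v) : HA v u := by
  unfold HA at *; omega

theorem HA.bounds {u v : Site} (h : HA u v) : v.1 ≤ u.1 + 1 ∧ u.1 ≤ v.1 + 1 ∧ v.2 ≤ u.2 + 1 ∧
    u.2 ≤ v.2 + 1 ∧ v.1 + v.2 ≤ u.1 + u.2 + 1 ∧ u.1 + u.2 ≤ v.1 + v.2 + 1 := by
  unfold HA at h; omega

/-- `u` and `v` are joined by a path inside `X`. -/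
def Cn (X : Set Site) (u v : Site) : Prop :=
  u ∈ X ∧ Relation.ReflTransGen (fun a b => HA a b ∧ b ∈ X) u v

theorem Cn.refl {X : Set Site} {u : Site} (h : u ∈ X) : Cn X u u := ⟨h, .refl⟩

theorem Cn.left {X : Set Site} {u v : Site} (h : Cn X u v) : u ∈ X := h.1

theorem Cn.right {X : Set Site} {u v : Site} (h : Cn X u v) : v ∈ X := by
  rcases h with ⟨h1, h2⟩
  induction h2 with
  | refl => exact h1
  | tail _ h _ => exact h.2

theorem Cn.trans {X : Set Site} {u v w : Site} (h : Cn X u v) (h' : Cn X v w) : Cn X u w :=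
  ⟨h.1, h.2.trans h'.2⟩

theorem Cn.step {X : Set Site} {u v : Site} (hu : u ∈ X) (h : HA u v) (hv : v ∈ X) : Cn X u v :=
  ⟨hu, .single ⟨h, hv⟩⟩

theorem Cn.tail {X : Set Site} {u v w : Site} (h : Cn X u v) (hvw : HA v w) (hw : w ∈ X) :
    Cn X u w := h.trans (Cn.step h.right hvw hw)

/-- Induction along a path. -/
theorem Cn.ind {X : Set Site} {u v : Site} (h : Cn X u v) (I : Site → Prop) (h0 : I u)
    (hs : ∀ a b, Cn X u a → I a → HA a b → b ∈ X → I b) : I v := by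
  rcases h with ⟨h1, h2⟩
  induction h2 with
  | refl => exact h0
  | tail hab hbc ih => exact hs _ _ ⟨h1, hab⟩ ih hbc.1 hbc.2

theorem Cn.symm {X : Set Site} {u v : Site} (h : Cn X u v) : Cn X v u :=
  h.ind (fun a => Cn X a u) (Cn.refl h.1)
    (fun _ _ _ ih hab hb => (Cn.step hb hab.symm ih.left).trans ih)

theorem Cn.map {X Y : Set Site} {u v : Site} (h : Cn X u v) (σ : Site → Site)
    (hσ : ∀ a b, HA a b → HA (σ a) (σ b)) (hXY : ∀ a ∈ X, σ a ∈ Y) : Cn Y (σ u) (σ v) :=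
  h.ind (fun a => Cn Y (σ u) (σ a)) (Cn.refl (hXY _ h.1))
    (fun _ _ _ ih hab hb => ih.tail (hσ _ _ hab) (hXY _ hb))

theorem Cn.mono {X Y : Set Site} {u v : Site} (h : Cn X u v) (hXY : X ⊆ Y) : Cn Y u v :=
  h.map id (fun _ _ h => h) (fun _ ha => hXY ha)

/-- First exit from `Y`. -/
theorem Cn.exit {X Y : Set Site} {u v : Site} (h : Cn X u v) (hu : u ∈ Y) (hv : v ∉ Y) :
    ∃ a b, Cn (X ∩ Y) u a ∧ HA a b ∧ b ∈ X ∧ b ∉ Y := by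
  have := h.ind (fun a => Cn (X ∩ Y) u a ∨ ∃ a b, Cn (X ∩ Y) u a ∧ HA a b ∧ b ∈ X ∧ b ∉ Y)
    (Or.inl (Cn.refl ⟨h.1, hu⟩)) (by
      rintro a b - (ih | ih) hab hb
      · by_cases hbY : b ∈ Y
        · exact Or.inl (ih.tail hab ⟨hb, hbY⟩)
        · exact Or.inr ⟨a, b, ih, hab, hb, hbY⟩
      · exact Or.inr ih)
  rcases this with hk | hk
  · exact absurd hk.right.2 hv
  · exact hk

/-- Last exit from `Y`. -/
theorem Cn.lastExit {X Y : Set Site} {u v : Site} (h : Cn X u v) (hu : u ∈ Y) (hv : v ∉ Y) :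
    ∃ a b, a ∈ X ∧ a ∈ Y ∧ HA a b ∧ Cn (X ∩ Yᶜ) b v := by
  obtain ⟨a, b, h1, h2, h3, h4⟩ := h.symm.exit (Y := Yᶜ) hv (by simpa using hu)
  exact ⟨b, a, h3, by simpa using h4, h2.symm, h1.symm⟩

/-- Extract a crossing of a strip. -/
theorem Cn.strip {X : Set Site} {u v : Site} (h : Cn X u v) (φ : Site → ℤ)
    (hφ : ∀ a b, HA a b → φ b ≤ φ a + 1) {a b : ℤ} (hab : a ≤ b) (hu : φ u ≤ a) (hv : b ≤ φ v) :
    ∃ u' v', φ u' = a ∧ φ v' = b ∧ Cn (X ∩ {w | a ≤ φ w ∧ φ w ≤ b}) u' v' := by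
  have h1 : ∃ u', φ u' = a ∧ Cn (X ∩ {w | a ≤ φ w}) u' v := by
    by_cases hua : φ u = a
    · by_cases hva : φ v = a
      · exact ⟨v, hva, Cn.refl ⟨h.right, by simp [hva]⟩⟩
      · obtain ⟨c, d, hc, hcY, hcd, hd⟩ := h.lastExit (Y := {w | φ w ≤ a}) (by simp [hua])
          (by simp; omega)
        have e1 := hφ _ _ hcd
        have e2 := hd.left.2
        simp only [Set.mem_compl_iff, Set.mem_ofPred_eq, not_le] at e2 hcY
        refine ⟨c, by omega, ?_⟩
        have hs : Cn (X ∩ {w | a ≤ φ w}) c d :=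
          Cn.step ⟨hc, by simp; omega⟩ hcd ⟨hd.left.1, by simp; omega⟩
        refine hs.trans (hd.mono ?_)
        rintro w ⟨hw1, hw2⟩
        simp only [Set.mem_compl_iff, Set.mem_ofPred_eq, not_le] at hw2
        exact ⟨hw1, by simp; omega⟩
    · obtain ⟨c, d, hc, hcY, hcd, hd⟩ := h.lastExit (Y := {w | φ w < a}) (by simp; omega)
          (by simp; omega)
      have e1 := hφ _ _ hcd
      have e2 := hd.left.2
      simp only [Set.mem_compl_iff, Set.mem_ofPred_eq, not_lt] at e2 hcY
      refine ⟨d, by omega, hd.mono ?_⟩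
      rintro w ⟨hw1, hw2⟩
      simp only [Set.mem_compl_iff, Set.mem_ofPred_eq, not_lt] at hw2
      exact ⟨hw1, hw2⟩
  obtain ⟨u', hu', h1⟩ := h1
  by_cases hub : φ u' = b
  · exact ⟨u', u', hu', hub, Cn.refl ⟨h1.left.1, by simp; omega⟩⟩
  · by_cases hvb : φ v = b
    · obtain ⟨c, d, hc, hcd, hd, hdY⟩ := h1.exit (Y := {w | φ w < b}) (by simp; omega)
        (by simp; omega)
      have e1 := hφ _ _ hcd
      have e2 := hc.right.2
      simp only [Set.mem_ofPred_eq, not_lt] at e2 hdY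
      refine ⟨u', d, hu', by omega, ?_⟩
      refine (hc.mono ?_).tail hcd ⟨hd.1, hd.2, by omega⟩
      rintro w ⟨⟨hw1, hw3⟩, hw2⟩
      simp only [Set.mem_ofPred_eq] at hw2 hw3
      exact ⟨hw1, by simp; omega⟩
    · obtain ⟨c, d, hc, hcd, hd, hdY⟩ := h1.exit (Y := {w | φ w < b}) (by simp; omega)
        (by simp; omega)
      have e1 := hφ _ _ hcd
      have e2 := hc.right.2
      simp only [Set.mem_ofPred_eq, not_lt] at e2 hdY
      refine ⟨u', d, hu', by omega, ?_⟩
      refine (hc.mono ?_).tail hcd ⟨hd.1, hd.2, by omega⟩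
      rintro w ⟨⟨hw1, hw3⟩, hw2⟩
      simp only [Set.mem_ofPred_eq] at hw2 hw3
      exact ⟨hw1, by simp; omega⟩

/-- A path as a sequence. -/
theorem Cn.seq {X : Set Site} {u v : Site} (h : Cn X u v) :
    ∃ (T : ℕ) (P : ℕ → Site), P 0 = u ∧ P T = v ∧ (∀ i < T, HA (P i) (P (i + 1))) ∧
      ∀ i ≤ T, Cn X u (P i) := by
  refine h.ind (fun a => ∃ (T : ℕ) (P : ℕ → Site), P 0 = u ∧ P T = a ∧
    (∀ i < T, HA (P i) (P (i + 1))) ∧ ∀ i ≤ T, Cn X u (P i)) ?_ ?_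
  · exact ⟨0, fun _ => u, rfl, rfl, by simp, fun _ _ => Cn.refl h.1⟩
  · rintro a b ha ⟨T, P, h0, hT, hP, hX⟩ hab hb
    refine ⟨T + 1, fun i => if i ≤ T then P i else b, by simp [h0], by simp, ?_, ?_⟩
    · intro i hi
      by_cases hiT : i < T
      · have : i + 1 ≤ T := hiT
        simp only [this, hiT.le, if_true]
        exact hP i hiT
      · have : i = T := by omega
        subst this
        simpa [hT] using hab
    · intro i hi
      by_cases hiT : i ≤ T
      · simpa [hiT] using hX i hiT
      · simpa [hiT] using ha.tail hab hb

/-- The vertical segment. -/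
theorem Cn.vert {X : Set Site} (x : ℤ) {a b : ℤ} (hab : a ≤ b)
    (h : ∀ y, a ≤ y → y ≤ b → (x, y) ∈ X) : Cn X (x, a) (x, b) := by
  obtain ⟨k, rfl⟩ := Int.le.dest hab
  induction k with
  | zero => simpa using Cn.refl (h a le_rfl (by simp))
  | succ k ih =>
    have := ih (by simp) (fun y h1 h2 => h y h1 (by push_cast; omega))
    refine this.tail (by simp [HA]; omega) (h _ (by push_cast; omega) (by simp))

theorem Cn.horiz {X : Set Site} (y : ℤ) {a b : ℤ} (hab : a ≤ b)
    (h : ∀ x, a ≤ x → x ≤ b → (x, y) ∈ X) : Cn X (a, y) (b, y) := by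
  obtain ⟨k, rfl⟩ := Int.le.dest hab
  induction k with
  | zero => simpa using Cn.refl (h a le_rfl (by simp))
  | succ k ih =>
    have := ih (by simp) (fun y h1 h2 => h y h1 (by push_cast; omega))
    refine this.tail (by simp [HA]; omega) (h _ (by push_cast; omega) (by simp))

/-! ### Intersection of paths: a discrete winding number -/

/-- Signed crossings of the vertical half-line above the origin. -/
def wc (x y x' : ℤ) (y' : ℤ) : ℤ :=
  if x = 0 ∧ 1 ≤ y ∧ x' = 1 then 1 else if x' = 0 ∧ 1 ≤ y' ∧ x = 1 then -1 else 0

theorem wc_up {x y x' y' : ℤ} (h : x = 0 → 1 ≤ y) (h' : x' = 0 → 1 ≤ y')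
    (h1 : x' ≤ x + 1) (h2 : x ≤ x' + 1) :
    wc x y x' y' = (if 1 ≤ x' then 1 else 0) - (if 1 ≤ x then 1 else 0) := by
  unfold wc
  split_ifs <;> omega

theorem wc_down {x y x' y' : ℤ} (h : x = 0 → y ≤ -1) (h' : x' = 0 → y' ≤ -1) :
    wc x y x' y' = 0 := by
  unfold wc
  split_ifs <;> omega

theorem wc_square {p p' q q' : Site} (hp : HA p p') (hq : HA q q')
    (h00 : p ≠ q) (h10 : p' ≠ q) (h01 : p ≠ q') (h11 : p' ≠ q') :
    wc (p.1 - q.1) (p.2 - q.2) (p'.1 - q.1) (p'.2 - q.2)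
      + wc (p'.1 - q.1) (p'.2 - q.2) (p'.1 - q'.1) (p'.2 - q'.2)
    = wc (p.1 - q.1) (p.2 - q.2) (p.1 - q'.1) (p.2 - q'.2)
      + wc (p.1 - q'.1) (p.2 - q'.2) (p'.1 - q'.1) (p'.2 - q'.2) := by
  obtain ⟨p1, p2⟩ := p
  obtain ⟨q1, q2⟩ := q
  obtain ⟨p1', p2'⟩ := p'
  obtain ⟨q1', q2'⟩ := q'
  have l1 := hp.bounds
  have l2 := hq.bounds
  simp only [ne_eq, Prod.mk.injEq] at *
  have hd : ((p1 - q1 = 0 → 1 ≤ p2 - q2) ∧ (p1' - q1 = 0 → 1 ≤ p2' - q2) ∧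
      (p1 - q1' = 0 → 1 ≤ p2 - q2') ∧ (p1' - q1' = 0 → 1 ≤ p2' - q2')) ∨
      ((p1 - q1 = 0 → p2 - q2 ≤ -1) ∧ (p1' - q1 = 0 → p2' - q2 ≤ -1) ∧
      (p1 - q1' = 0 → p2 - q2' ≤ -1) ∧ (p1' - q1' = 0 → p2' - q2' ≤ -1)) := by
    clear hp hq
    by_cases c1 : p1 - q1 = 0 ∧ p2 - q2 ≤ 0
    · right; refine ⟨?_, ?_, ?_, ?_⟩ <;> omega
    by_cases c2 : p1' - q1 = 0 ∧ p2' - q2 ≤ 0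
    · right; refine ⟨?_, ?_, ?_, ?_⟩ <;> omega
    by_cases c3 : p1 - q1' = 0 ∧ p2 - q2' ≤ 0
    · right; refine ⟨?_, ?_, ?_, ?_⟩ <;> omega
    by_cases c4 : p1' - q1' = 0 ∧ p2' - q2' ≤ 0
    · right; refine ⟨?_, ?_, ?_, ?_⟩ <;> omega
    left; refine ⟨?_, ?_, ?_, ?_⟩ <;> omega
  clear hp hq h00 h01 h10 h11
  rcases hd with ⟨d1, d2, d3, d4⟩ | ⟨d1, d2, d3, d4⟩
  · rw [wc_up d1 d2 (by omega) (by omega), wc_up d2 d4 (by omega) (by omega),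
      wc_up d1 d3 (by omega) (by omega), wc_up d3 d4 (by omega) (by omega)]
    ring
  · rw [wc_down d1 d2, wc_down d2 d4, wc_down d1 d3, wc_down d3 d4]

theorem wc_loop (P Q : ℕ → Site) (m n : ℕ) (hP : ∀ i < m, HA (P i) (P (i + 1)))
    (hQ : ∀ i < n, HA (Q i) (Q (i + 1))) (hne : ∀ i ≤ m, ∀ j ≤ n, P i ≠ Q j) :
    (∑ i ∈ Finset.range m, wc ((P i).1 - (Q 0).1) ((P i).2 - (Q 0).2)
        ((P (i + 1)).1 - (Q 0).1) ((P (i + 1)).2 - (Q 0).2))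
      + (∑ j ∈ Finset.range n, wc ((P m).1 - (Q j).1) ((P m).2 - (Q j).2)
        ((P m).1 - (Q (j + 1)).1) ((P m).2 - (Q (j + 1)).2))
    = (∑ j ∈ Finset.range n, wc ((P 0).1 - (Q j).1) ((P 0).2 - (Q j).2)
        ((P 0).1 - (Q (j + 1)).1) ((P 0).2 - (Q (j + 1)).2))
      + (∑ i ∈ Finset.range m, wc ((P i).1 - (Q n).1) ((P i).2 - (Q n).2)
        ((P (i + 1)).1 - (Q n).1) ((P (i + 1)).2 - (Q n).2)) := by
  induction n with
  | zero => simp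
  | succ n ih =>
    have ih := ih (fun i hi => hQ i (by omega)) (fun i hi j hj => hne i hi j (by omega))
    have key : ∀ k ≤ m, (∑ i ∈ Finset.range k, wc ((P i).1 - (Q n).1) ((P i).2 - (Q n).2)
        ((P (i + 1)).1 - (Q n).1) ((P (i + 1)).2 - (Q n).2))
        + wc ((P k).1 - (Q n).1) ((P k).2 - (Q n).2)
        ((P k).1 - (Q (n + 1)).1) ((P k).2 - (Q (n + 1)).2)
        = wc ((P 0).1 - (Q n).1) ((P 0).2 - (Q n).2)
        ((P 0).1 - (Q (n + 1)).1) ((P 0).2 - (Q (n + 1)).2) +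
        ∑ i ∈ Finset.range k, wc ((P i).1 - (Q (n + 1)).1) ((P i).2 - (Q (n + 1)).2)
        ((P (i + 1)).1 - (Q (n + 1)).1) ((P (i + 1)).2 - (Q (n + 1)).2) := by
      intro k
      induction k with
      | zero => intro _; simp
      | succ k ihk =>
        intro hk
        have ihk := ihk (by omega)
        have sq := wc_square (hP k (by omega)) (hQ n (by omega))
          (hne k (by omega) n (by omega)) (hne (k + 1) (by omega) n (by omega))
          (hne k (by omega) (n + 1) (by omega)) (hne (k + 1) (by omega) (n + 1) (by omega))
        rw [Finset.sum_range_succ, Finset.sum_range_succ]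
        linarith
    have := key m le_rfl
    rw [Finset.sum_range_succ, Finset.sum_range_succ]
    linarith

/-- Telescoping. -/
theorem sum_tele (m : ℕ) (F : ℕ → ℤ) (G : ℕ → ℤ) (h : ∀ i < m, G i = F (i + 1) - F i) :
    ∑ i ∈ Finset.range m, G i = F m - F 0 := by
  rw [← Finset.sum_range_sub]
  exact Finset.sum_congr rfl (fun i hi => h i (Finset.mem_range.1 hi))

/-- Horizontal path `P` and vertical path `Q` intersect. -/
theorem cross_HV {X Y : Set Site} {p p' q q' : Site} (hP : Cn X p p') (hQ : Cn Y q q')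
    (h1 : ∀ w ∈ Y, p.1 ≤ w.1) (h2 : ∀ w ∈ Y, w.1 ≤ p'.1)
    (h3 : ∀ w ∈ X, w.1 = q.1 → q.2 ≤ w.2) (h4 : ∀ w ∈ X, w.1 = q'.1 → w.2 ≤ q'.2) :
    ∃ w, Cn X p w ∧ Cn Y q w := by
  obtain ⟨m, P, P0, Pm, hPs, hPX⟩ := hP.seq
  obtain ⟨n, Q, Q0, Qn, hQs, hQY⟩ := hQ.seq
  by_contra hcon
  have hne : ∀ i ≤ m, ∀ j ≤ n, P i ≠ Q j := fun i hi j hj he =>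
    hcon ⟨P i, hPX i hi, he ▸ hQY j hj⟩
  have hne' : ∀ i ≤ m, ∀ j ≤ n, ¬ ((P i).1 = (Q j).1 ∧ (P i).2 = (Q j).2) := fun i hi j hj he =>
    hne i hi j hj (Prod.ext he.1 he.2)
  have L := wc_loop P Q m n hPs hQs hne
  have e1 : ∀ j ≤ n, p.1 ≤ (Q j).1 := fun j hj => h1 _ (hQY j hj).right
  have e2 : ∀ j ≤ n, (Q j).1 ≤ p'.1 := fun j hj => h2 _ (hQY j hj).right
  have e3 : ∀ i ≤ m, (P i).1 = (Q 0).1 → (Q 0).2 ≤ (P i).2 := fun i hi => by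
    rw [Q0]; exact h3 _ (hPX i hi).right
  have e4 : ∀ i ≤ m, (P i).1 = (Q n).1 → (P i).2 ≤ (Q n).2 := fun i hi => by
    rw [Qn]; exact h4 _ (hPX i hi).right
  rw [← P0] at e1
  rw [← Pm] at e2
  rw [sum_tele m (fun i => if 1 ≤ (P i).1 - (Q 0).1 then 1 else 0),
    sum_tele n (fun j => if (P m).1 - (Q j).1 = 0 ∧ 1 ≤ (P m).2 - (Q j).2 then -1 else 0),
    sum_tele n (fun _ => 0), sum_tele m (fun _ => 0)] at L
  · have a1 := e1 0 (by omega)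
    have a2 := e2 0 (by omega)
    have a3 := e3 m (by omega)
    have a4 := e4 m (by omega)
    have a5 := hne' m (by omega) 0 (by omega)
    simp only [sub_self] at L
    split_ifs at L <;> omega
  · intro i hi
    have a1 := e4 i (by omega)
    have a2 := e4 (i + 1) (by omega)
    have a3 := hne' i (by omega) n (by omega)
    have a4 := hne' (i + 1) (by omega) n (by omega)
    unfold wc
    split_ifs <;> omega
  · intro j hj
    have a1 := e1 j (by omega)
    have a2 := e1 (j + 1) (by omega)
    unfold wc
    split_ifs <;> omega
  · intro j hj
    have a1 := e2 j (by omega)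
    have a2 := e2 (j + 1) (by omega)
    have a3 := hne' m (by omega) j (by omega)
    have a4 := hne' m (by omega) (j + 1) (by omega)
    have a5 := hQs j hj
    unfold HA at a5
    unfold wc
    split_ifs <;> omega
  · intro i hi
    have a1 := e3 i (by omega)
    have a2 := e3 (i + 1) (by omega)
    have a3 := hne' i (by omega) 0 (by omega)
    have a4 := hne' (i + 1) (by omega) 0 (by omega)
    have a5 := hPs i hi
    unfold HA at a5
    unfold wc
    split_ifs <;> omega

/-- Path `P` from the left to the top right, path `Q` from the right to the top left. -/
theorem cross_top {X Y : Set Site} {p p' q q' : Site} (hP : Cn X p p') (hQ : Cn Y q q')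
    (h1 : ∀ w ∈ Y, p.1 ≤ w.1) (h2 : ∀ w ∈ X, w.1 ≤ q.1)
    (h3 : ∀ w ∈ Y, w.1 = p'.1 → w.2 ≤ p'.2) (h4 : ∀ w ∈ X, w.1 = q'.1 → w.2 ≤ q'.2)
    (h5 : q'.1 ≤ p'.1) :
    ∃ w, Cn X p w ∧ Cn Y q w := by
  obtain ⟨m, P, P0, Pm, hPs, hPX⟩ := hP.seq
  obtain ⟨n, Q, Q0, Qn, hQs, hQY⟩ := hQ.seq
  by_contra hcon
  have hne : ∀ i ≤ m, ∀ j ≤ n, P i ≠ Q j := fun i hi j hj he =>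
    hcon ⟨P i, hPX i hi, he ▸ hQY j hj⟩
  have hne' : ∀ i ≤ m, ∀ j ≤ n, ¬ ((P i).1 = (Q j).1 ∧ (P i).2 = (Q j).2) := fun i hi j hj he =>
    hne i hi j hj (Prod.ext he.1 he.2)
  have L := wc_loop P Q m n hPs hQs hne
  have e1 : ∀ j ≤ n, p.1 ≤ (Q j).1 := fun j hj => h1 _ (hQY j hj).right
  have e2 : ∀ i ≤ m, (P i).1 ≤ q.1 := fun i hi => h2 _ (hPX i hi).right
  have e3 : ∀ j ≤ n, (Q j).1 = (P m).1 → (Q j).2 ≤ (P m).2 := fun j hj => by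
    rw [Pm]; exact h3 _ (hQY j hj).right
  have e4 : ∀ i ≤ m, (P i).1 = (Q n).1 → (P i).2 ≤ (Q n).2 := fun i hi => by
    rw [Qn]; exact h4 _ (hPX i hi).right
  rw [← P0] at e1
  rw [← Q0] at e2
  rw [← Pm, ← Qn] at h5
  rw [sum_tele m (fun _ => 0),
    sum_tele n (fun j => if 1 ≤ (P m).1 - (Q j).1 then 1 else 0),
    sum_tele n (fun _ => 0), sum_tele m (fun _ => 0)] at L
  · have a1 := e2 m (by omega)
    have a3 := e3 n (by omega)
    have a4 := e4 m (by omega)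
    have a5 := hne' m (by omega) n (by omega)
    simp only [sub_self] at L
    split_ifs at L <;> omega
  · intro i hi
    have a1 := e4 i (by omega)
    have a2 := e4 (i + 1) (by omega)
    have a3 := hne' i (by omega) n (by omega)
    have a4 := hne' (i + 1) (by omega) n (by omega)
    unfold wc
    split_ifs <;> omega
  · intro j hj
    have a1 := e1 j (by omega)
    have a2 := e1 (j + 1) (by omega)
    unfold wc
    split_ifs <;> omega
  · intro j hj
    have a1 := e3 j (by omega)
    have a2 := e3 (j + 1) (by omega)
    have a3 := hne' m (by omega) j (by omega)
    have a4 := hne' m (by omega) (j + 1) (by omega)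
    have a5 := hQs j hj
    unfold HA at a5
    unfold wc
    split_ifs <;> omega
  · intro i hi
    have a1 := e2 i (by omega)
    have a2 := e2 (i + 1) (by omega)
    unfold wc
    split_ifs <;> omega


/-! ### Exactness modulo two and the Hex lemma -/

theorem int_pot (d : ℤ → ZMod 2) : ∃ h : ℤ → ZMod 2, h 0 = 0 ∧ ∀ y, h (y + 1) = h y + d y := by
  refine ⟨fun y => ∑ i ∈ Finset.range y.toNat, d i + ∑ i ∈ Finset.range (-y).toNat, d (-(i + 1)),
    by simp, ?_⟩
  intro y
  rcases le_or_gt 0 y with hy | hy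
  · obtain ⟨k, rfl⟩ := Int.eq_ofNat_of_zero_le hy
    have e1 : ((k : ℤ) + 1).toNat = k + 1 := by omega
    have e2 : (-((k : ℤ) + 1)).toNat = 0 := by omega
    have e3 : (-(k : ℤ)).toNat = 0 := by omega
    simp only [e1, e2, e3, Finset.sum_range_succ, Finset.sum_range_zero, Int.toNat_natCast]
    ring
  · obtain ⟨k, hk⟩ : ∃ k : ℕ, y = -((k : ℤ) + 1) := ⟨(-y - 1).toNat, by omega⟩
    subst hk
    have e1 : (-((k : ℤ) + 1) + 1).toNat = 0 := by omega
    have e2 : (-(-((k : ℤ) + 1) + 1)).toNat = k := by omega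
    have e3 : (-((k : ℤ) + 1)).toNat = 0 := by omega
    have e4 : (-(-((k : ℤ) + 1))).toNat = k + 1 := by omega
    simp only [e1, e2, e3, e4, Finset.sum_range_succ, Finset.sum_range_zero]
    have : d (-((k : ℤ) + 1)) + d (-((k : ℤ) + 1)) = 0 := CharTwo.add_self_eq_zero _
    linear_combination -this

theorem exact2 (M : ℤ) (f : Site → Site → ZMod 2) (hs : ∀ u v, f u v = f v u)
    (t1 : ∀ x y, x + 1 ≤ M → f (x, y) (x + 1, y) + f (x, y) (x, y + 1)
      + f (x + 1, y) (x, y + 1) = 0)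
    (t2 : ∀ x y, x + 1 ≤ M → f (x + 1, y) (x, y + 1) + f (x, y + 1) (x + 1, y + 1)
      + f (x + 1, y) (x + 1, y + 1) = 0) :
    ∃ g : Site → ZMod 2, ∀ u v, HA u v → u.1 ≤ M → v.1 ≤ M → f u v = g u + g v := by
  choose h h0 h1 using fun x : ℤ => int_pot (fun y => f (x, y) (x, y + 1))
  obtain ⟨k, k0, k1⟩ := int_pot (fun x => f (x, 0) (x + 1, 0))
  have two : ∀ a : ZMod 2, a + a = 0 := fun a => CharTwo.add_self_eq_zero a
  have vert : ∀ x y, f (x, y) (x, y + 1) = (k x + h x y) + (k x + h x (y + 1)) := by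
    intro x y
    have := h1 x y
    linear_combination -this - two (k x) - two (h x y) 
  have hor : ∀ x, x + 1 ≤ M → ∀ y, f (x, y) (x + 1, y) = (k x + h x y) + (k (x + 1) + h (x + 1) y) := by
    intro x hx
    have D : ∀ y, f (x, y) (x + 1, y) + ((k x + h x y) + (k (x + 1) + h (x + 1) y))
        = f (x, y + 1) (x + 1, y + 1) + ((k x + h x (y + 1)) + (k (x + 1) + h (x + 1) (y + 1))) := by
      intro y
      have a1 := t1 x y hx
      have a2 := t2 x y hx
      have a3 := h1 x y
      have a4 := h1 (x + 1) y
      have b1 := two (f (x + 1, y) (x, y + 1))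
      have b2 := two (f (x, y + 1) (x + 1, y + 1))
      have b3 := two (f (x, y) (x, y + 1))
      have b4 := two (f (x + 1, y) (x + 1, y + 1))
      linear_combination a1 + a2 - a3 - a4 - b1 - b2 - b3 - b4
    have Z : ∀ y, f (x, y) (x + 1, y) + ((k x + h x y) + (k (x + 1) + h (x + 1) y)) = 0 := by
      intro y
      induction y with
      | zero =>
        have := k1 x
        have c := h0 x
        have c' := h0 (x + 1)
        linear_combination this + c + c' + two (k x) + two (f (x, 0) (x + 1, 0))
      | succ i ih => rw [D] at ih; exact ih
      | pred i ih =>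
        have := D (-(i : ℤ) - 1)
        rw [sub_add_cancel] at this
        rw [this]; exact ih
    intro y
    have := Z y
    linear_combination this - two (k x + h x y) - two (k (x + 1) + h (x + 1) y)
  have diag : ∀ x, x + 1 ≤ M → ∀ y, f (x + 1, y) (x, y + 1)
      = (k (x + 1) + h (x + 1) y) + (k x + h x (y + 1)) := by
    intro x hx y
    have a1 := t1 x y hx
    have a2 := hor x hx y
    have a3 := vert x y
    linear_combination a1 - a2 - a3 - two (k x + h x y) - two (k (x + 1) + h (x + 1) y)
      - two (k x + h x (y + 1))
  refine ⟨fun u => k u.1 + h u.1 u.2, ?_⟩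
  rintro ⟨x, y⟩ ⟨x', y'⟩ huv hu hv
  simp only [HA] at huv hu hv ⊢
  rcases huv with ⟨rfl, rfl⟩ | ⟨rfl, rfl⟩ | ⟨rfl, rfl⟩ | ⟨rfl, rfl⟩ | ⟨rfl, rfl⟩ | ⟨rfl, rfl⟩
  · exact hor x hv _
  · have := hor (x - 1) (by omega) y'
    rw [sub_add_cancel] at this
    rw [hs, this, add_comm]
  · exact vert _ _
  · have := vert x' (y - 1)
    rw [sub_add_cancel] at this
    rw [hs, this, add_comm]
  · have := diag x hv (y - 1)
    rw [sub_add_cancel] at this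
    rw [hs, this, add_comm]
  · have := diag (x - 1) (by omega) y
    rw [sub_add_cancel] at this
    rw [this]

/-- There is an edge between `A` and `W`. -/
def AW (A W : Set Site) (u v : Site) : Prop := (u ∈ A ∧ v ∈ W) ∨ (u ∈ W ∧ v ∈ A)

open Classical in
theorem tri_prop {a1 a2 a3 b1 b2 b3 : Prop} (d1 : a1 → ¬ b1) (d2 : a2 → ¬ b2) (d3 : a3 → ¬ b3)
    (c1 : a1 → b2 → a3 ∨ b3) (c2 : a2 → b1 → a3 ∨ b3) (c3 : a1 → b3 → a2 ∨ b2)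
    (c4 : a3 → b1 → a2 ∨ b2) (c5 : a2 → b3 → a1 ∨ b1) (c6 : a3 → b2 → a1 ∨ b1) :
    (if (a1 ∧ b2) ∨ (b1 ∧ a2) then (1 : ZMod 2) else 0) +
      (if (a1 ∧ b3) ∨ (b1 ∧ a3) then 1 else 0) + (if (a2 ∧ b3) ∨ (b2 ∧ a3) then 1 else 0) = 0 := by
  have two : (1 : ZMod 2) + 1 = 0 := by decide
  by_cases h1 : a1
  · have := d1 h1
    by_cases h2 : a2 <;> by_cases h3 : a3 <;> by_cases h4 : b2 <;> by_cases h5 : b3 <;>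
      simp_all
  · by_cases h6 : b1
    · by_cases h2 : a2 <;> by_cases h3 : a3 <;> by_cases h4 : b2 <;> by_cases h5 : b3 <;>
        simp_all
    · by_cases h2 : a2 <;> by_cases h3 : a3 <;> by_cases h4 : b2 <;> by_cases h5 : b3 <;>
        simp_all

theorem parity (M : ℤ) (A W : Set Site) (hd : ∀ v ∈ A, v ∉ W)
    (hc : ∀ a ∈ A, ∀ w ∈ W, ∀ c : Site, HA a w → HA a c → HA w c → a.1 ≤ M → w.1 ≤ M → c.1 ≤ M →
      c ∈ A ∨ c ∈ W) :
    ∃ g : Site → ZMod 2, ∀ u v, HA u v → u.1 ≤ M → v.1 ≤ M → (g u = g v ↔ ¬ AW A W u v) := by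
  classical
  have T : ∀ u v w : Site, HA u v → HA u w → HA v w → u.1 ≤ M → v.1 ≤ M → w.1 ≤ M →
      (if AW A W u v then (1 : ZMod 2) else 0) + (if AW A W u w then 1 else 0)
        + (if AW A W v w then 1 else 0) = 0 := by
    intro u v w h1 h2 h3 m1 m2 m3
    have c1 := fun a b => hc u a v b w h1 h2 h3 m1 m2 m3
    have c2 := fun a b => hc v a u b w h1.symm h3 h2 m2 m1 m3
    have c3 := fun a b => hc u a w b v h2 h1 h3.symm m1 m3 m2
    have c4 := fun a b => hc w a u b v h2.symm h3.symm h1 m3 m1 m2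
    have c5 := fun a b => hc v a w b u h3 h1.symm h2.symm m2 m3 m1
    have c6 := fun a b => hc w a v b u h3.symm h2.symm h1.symm m3 m2 m1
    have d1 := hd u
    have d2 := hd v
    have d3 := hd w
    convert tri_prop d1 d2 d3 c1 c2 c3 c4 c5 c6 using 5 <;> exact Iff.rfl
  obtain ⟨g, hg⟩ := exact2 M (fun u v => if AW A W u v then 1 else 0)
    (by
      intro u v
      have : AW A W u v ↔ AW A W v u := by unfold AW; tauto
      simp only [this])
    (fun x y hx => T _ _ _ (by simp [HA]) (by simp [HA]) (by simp [HA]) (by simp; omega) hx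
      (by simp; omega))
    (fun x y hx => by
      have := T (x, y + 1) (x + 1, y) (x + 1, y + 1) (by simp [HA]) (by simp [HA]) (by simp [HA])
        (by simp; omega) hx hx
      have e : AW A W (x + 1, y) (x, y + 1) ↔ AW A W (x, y + 1) (x + 1, y) := by unfold AW; tauto
      simp only [e]
      exact this)
  refine ⟨g, fun u v h h1 h2 => ?_⟩
  have := hg u v h h1 h2
  have two : g v + g v = 0 := CharTwo.add_self_eq_zero _
  constructor
  · intro e ha
    simp only [ha, if_true, e, two] at this
    exact one_ne_zero this
  · intro ha
    simp only [ha, if_false] at this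
    linear_combination -this - two

theorem g_const {M : ℤ} {A W : Set Site} {g : Site → ZMod 2}
    (hg : ∀ u v, HA u v → u.1 ≤ M → v.1 ≤ M → (g u = g v ↔ ¬ AW A W u v))
    {X : Set Site} {u v : Site} (h : Cn X u v) (hM : ∀ w ∈ X, w.1 ≤ M)
    (hX : (∀ w ∈ X, w ∉ A) ∨ (∀ w ∈ X, w ∉ W)) : g u = g v := by
  refine h.ind (fun a => g u = g a) rfl ?_
  intro a b ha ih hab hb
  rw [ih, hg a b hab (hM _ ha.right) (hM _ hb)]
  rintro (⟨h1, h2⟩ | ⟨h1, h2⟩) <;> rcases hX with hX | hX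
  · exact hX _ ha.right h1
  · exact hX _ hb h2
  · exact hX _ hb h2
  · exact hX _ ha.right h1

/-- Parity for unions of black and of white components. -/
theorem hex_parity (M : ℤ) (S A W : Set Site) (hA : ∀ v ∈ A, v ∈ S) (hW : ∀ v ∈ W, v ∉ S)
    (cA : ∀ a ∈ A, ∀ c ∈ S, HA a c → c ∈ A) (cW : ∀ a ∈ W, ∀ c, c ∉ S → HA a c → c ∈ W) :
    ∃ g : Site → ZMod 2, ∀ u v, HA u v → u.1 ≤ M → v.1 ≤ M → (g u = g v ↔ ¬ AW A W u v) := by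
  refine parity M A W (fun v h h' => hW v h' (hA v h)) ?_
  intro a ha w hw c _ h1 h2 _ _ _
  by_cases hc : c ∈ S
  · exact Or.inl (cA a ha c hc h1)
  · exact Or.inr (cW w hw c hc h2)

/-- The parallelogram. -/
def Rect (x0 x1 y0 y1 : ℤ) : Set Site := {v | x0 ≤ v.1 ∧ v.1 ≤ x1 ∧ y0 ≤ v.2 ∧ v.2 ≤ y1}

theorem mem_Rect {x0 x1 y0 y1 : ℤ} {v : Site} :
    v ∈ Rect x0 x1 y0 y1 ↔ x0 ≤ v.1 ∧ v.1 ≤ x1 ∧ y0 ≤ v.2 ∧ v.2 ≤ y1 := Iff.rfl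

/-- `S` contains a path inside `R` from `a` to `b`. -/
def Cx (R a b : Set Site) (S : Set Site) : Prop := ∃ u v, u ∈ a ∧ v ∈ b ∧ Cn (S ∩ R) u v

/-- Hex: existence of one of the two crossings. -/
theorem hex (S : Set Site) {x0 x1 y0 y1 : ℤ} (hx : x0 ≤ x1) (hy : y0 ≤ y1) :
    Cx (Rect x0 x1 y0 y1) {v | v.1 = x0} {v | v.1 = x1} S ∨
    Cx (Rect x0 x1 y0 y1) {v | v.2 = y0} {v | v.2 = y1} Sᶜ := by
  by_contra hcon
  rw [not_or] at hcon
  obtain ⟨hB, hWh⟩ := hcon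
  set S' : Set Site := {v | v.1 < x0 ∨ x1 < v.1 ∨ (y0 ≤ v.2 ∧ v.2 ≤ y1 ∧ v ∈ S)} with hS'
  set A : Set Site := {v | Cn S' (x0 - 1, y0) v} with hA
  set W : Set Site := {v | Cn S'ᶜ (x0, y0 - 1) v} with hW
  have hAr : ∀ v, x1 < v.1 → v ∉ A := by
    intro v hv hvA
    obtain ⟨u', v', h1, h2, h3⟩ := Cn.strip (show Cn S' _ v from hvA) (fun w => w.1)
      (fun a b h => by have := h.bounds; omega) hx (by simp) (by omega)
    refine hB ⟨u', v', h1, h2, h3.mono ?_⟩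
    rintro w ⟨hw1, hw2⟩
    simp only [hS', Set.mem_ofPred_eq, mem_Rect, Set.mem_inter_iff] at *
    rcases hw1 with hw1 | hw1 | ⟨hw1, hw3, hw4⟩
    · omega
    · omega
    · exact ⟨hw4, by omega⟩
  have hWt : ∀ v, y1 < v.2 → v ∉ W := by
    intro v hv hvA
    obtain ⟨u', v', h1, h2, h3⟩ := Cn.strip (show Cn S'ᶜ _ v from hvA) (fun w => w.2)
      (fun a b h => by have := h.bounds; omega) hy (by simp) (by omega)
    refine hWh ⟨u', v', h1, h2, h3.mono ?_⟩
    rintro w ⟨hw1, hw2⟩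
    simp only [hS', Set.mem_ofPred_eq, mem_Rect, Set.mem_inter_iff, Set.mem_compl_iff, not_or,
      not_and] at *
    exact ⟨hw1.2.2 hw2.1 hw2.2, by omega⟩
  obtain ⟨g, hg⟩ := hex_parity (x1 + 1) S' A W (fun v h => h.right) (fun v h => h.right)
    (fun a ha c hc h => Cn.tail ha h hc) (fun a ha c hc h => Cn.tail ha h hc)
  have s0 : ((x0 - 1, y0) : Site) ∈ A := Cn.refl (by simp [hS'])
  have w0 : ((x0, y0 - 1) : Site) ∈ W := Cn.refl (by simp [hS']; omega)
  have e0 := hg (x0 - 1, y0) (x0, y0 - 1) (by simp [HA]) (by simp; omega) (by simp; omega)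
  have nA : ∀ v ∈ A, v ∈ S' := fun v h => h.right
  have nW : ∀ v ∈ W, v ∉ S' := fun v h => h.right
  -- around outside `A`
  have p1 : Cn {w | w.1 ≤ x1 + 1 ∧ (x1 < w.1 ∨ w ∉ S')} (x0, y0 - 1) (x0, y1 + 1) := by
    have q1 : Cn {w : Site | w.1 ≤ x1 + 1 ∧ (x1 < w.1 ∨ w ∉ S')} (x0, y0 - 1) (x1 + 1, y0 - 1) :=
      Cn.horiz _ (by omega) (by intro x h1 h2; simp [hS']; omega)
    have q2 : Cn {w : Site | w.1 ≤ x1 + 1 ∧ (x1 < w.1 ∨ w ∉ S')} (x1 + 1, y0 - 1) (x1 + 1, y1 + 1) :=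
      Cn.vert _ (by omega) (by intro x h1 h2; simp)
    have q3 : Cn {w : Site | w.1 ≤ x1 + 1 ∧ (x1 < w.1 ∨ w ∉ S')} (x0, y1 + 1) (x1 + 1, y1 + 1) :=
      Cn.horiz _ (by omega) (by intro x h1 h2; simp [hS']; omega)
    exact (q1.trans q2).trans q3.symm
  have c1 := g_const hg p1 (fun w h => h.1) (Or.inl (by
    rintro w ⟨h1, h2 | h2⟩ hw
    · exact hAr w h2 hw
    · exact h2 (nA w hw)))
  have p2 : Cn {w | w.1 ≤ x0 ∧ (y1 < w.2 ∨ w ∈ S')} (x0, y1 + 1) (x0 - 1, y0) := by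
    have q1 : Cn {w : Site | w.1 ≤ x0 ∧ (y1 < w.2 ∨ w ∈ S')} (x0 - 1, y1 + 1) (x0, y1 + 1) :=
      Cn.horiz _ (by omega) (by intro x h1 h2; simp; omega)
    have q2 : Cn {w : Site | w.1 ≤ x0 ∧ (y1 < w.2 ∨ w ∈ S')} (x0 - 1, y0) (x0 - 1, y1 + 1) :=
      Cn.vert _ (by omega) (by intro x h1 h2; simp [hS'])
    exact (q2.trans q1).symm
  have c2 := g_const hg p2 (fun w h => by have := h.1; omega) (Or.inr (by
    rintro w ⟨h1, h2 | h2⟩ hw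
    · exact hWt w h2 hw
    · exact nW w hw h2))
  exact (e0.1 (c1.trans c2).symm) (Or.inl ⟨s0, w0⟩)


/-! ### Probabilities of local events at the critical point -/

/-- The probability that the set of black sites has the property `E`. -/
def Pr (μ : Measure (Site → ℝ)) (E : Set Site → Prop) : ℝ :=
  (μ {ω | E {v | ω v ≤ 1 / 2}}).toReal

/-- The event depends only on the sites of `Λ`. -/
def DepOn (Λ : Finset Site) (E : Set Site → Prop) : Prop := ∀ S : Set Site, E S ↔ E (S ∩ ↑Λ)

theorem DepOn.mono {Λ Λ' : Finset Site} {E : Set Site → Prop} (h : DepOn Λ E) (hΛ : Λ ⊆ Λ') :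
    DepOn Λ' E := by
  intro S
  rw [h S, h (S ∩ ↑Λ'), Set.inter_assoc,
    Set.inter_eq_self_of_subset_right (Finset.coe_subset.2 hΛ)]

theorem marg {μ : Measure (Site → ℝ)} (hμ : IsUniformCoupling μ) (v : Site) :
    μ ((fun ω : Site → ℝ => ω v) ⁻¹' Set.Iic (1 / 2)) = ENNReal.ofReal (1 / 2) := by
  rw [← Measure.map_apply (measurable_pi_apply v) measurableSet_Iic, hμ.2.2 v,
    Measure.restrict_apply measurableSet_Iic]
  have : Set.Iic (1 / 2 : ℝ) ∩ Set.Icc 0 1 = Set.Icc 0 (1 / 2) := by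
    ext x; simp only [Set.mem_inter_iff, Set.mem_Iic, Set.mem_Icc]
    constructor
    · rintro ⟨h1, h2, h3⟩; exact ⟨h2, h1⟩
    · rintro ⟨h1, h2⟩; exact ⟨h2, h1, by linarith⟩
  rw [this, Real.volume_Icc]; norm_num

theorem marg' {μ : Measure (Site → ℝ)} (hμ : IsUniformCoupling μ) (v : Site) :
    μ ((fun ω : Site → ℝ => ω v) ⁻¹' Set.Ioi (1 / 2)) = ENNReal.ofReal (1 / 2) := by
  rw [← Measure.map_apply (measurable_pi_apply v) measurableSet_Ioi, hμ.2.2 v,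
    Measure.restrict_apply measurableSet_Ioi]
  have : Set.Ioi (1 / 2 : ℝ) ∩ Set.Icc 0 1 = Set.Ioc (1 / 2) 1 := by
    ext x; simp only [Set.mem_inter_iff, Set.mem_Ioi, Set.mem_Icc, Set.mem_Ioc]
    constructor
    · rintro ⟨h1, h2, h3⟩; exact ⟨h1, h3⟩
    · rintro ⟨h1, h2⟩; exact ⟨h1, by linarith, h2⟩
  rw [this, Real.volume_Ioc]; norm_num

open Classical in
theorem atom_eq {μ : Measure (Site → ℝ)} (hμ : IsUniformCoupling μ) (Λ T : Finset Site) :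
    μ (⋂ v ∈ Λ, (fun ω : Site → ℝ => ω v) ⁻¹' (if v ∈ T then Set.Iic (1 / 2) else Set.Ioi (1 / 2)))
      = ENNReal.ofReal (1 / 2) ^ Λ.card := by
  rw [hμ.2.1.measure_inter_preimage_eq_mul (S := Λ)
    (sets := fun v => if v ∈ T then Set.Iic (1 / 2) else Set.Ioi (1 / 2))]
  · rw [← Finset.prod_const]
    refine Finset.prod_congr rfl (fun v _ => ?_)
    by_cases h : v ∈ T
    · simp only [h, if_true]; exact marg hμ v
    · simp only [h, if_false]; exact marg' hμ v
  · intro v _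
    by_cases h : v ∈ T
    · simp only [h, if_true]; exact measurableSet_Iic
    · simp only [h, if_false]; exact measurableSet_Ioi

theorem Pr_eq {μ : Measure (Site → ℝ)} (hμ : IsUniformCoupling μ) {Λ : Finset Site}
    {E : Set Site → Prop} (hE : DepOn Λ E) [DecidablePred fun T : Finset Site => E (T : Set Site)] :
    Pr μ E = ((Λ.powerset.filter (fun T : Finset Site => E (T : Set Site))).card : ℝ) / 2 ^ Λ.card := by
  classical
  have hmem : ∀ (T : Finset Site), T ⊆ Λ → ∀ ω : Site → ℝ,
      (ω ∈ ⋂ v ∈ Λ, (fun ω : Site → ℝ => ω v) ⁻¹'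
        (if v ∈ T then Set.Iic (1 / 2) else Set.Ioi (1 / 2)) ↔
        {v | ω v ≤ 1 / 2} ∩ (Λ : Set Site) = T) := by
    intro T hT ω
    simp only [Set.mem_iInter, Set.mem_preimage]
    constructor
    · intro h
      ext v
      simp only [Set.mem_inter_iff, Set.mem_ofPred_eq, Finset.mem_coe]
      constructor
      · rintro ⟨h1, h2⟩
        by_contra hv
        have := h v h2
        simp only [hv, if_false, Set.mem_Ioi] at this
        linarith
      · intro hv
        have := h v (hT hv)
        simp only [hv, if_true, Set.mem_Iic] at this
        exact ⟨this, hT hv⟩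
    · intro h v hv
      have := Set.ext_iff.1 h v
      simp only [Set.mem_inter_iff, Set.mem_ofPred_eq, Finset.mem_coe, hv, and_true] at this
      by_cases hvT : v ∈ T
      · simp only [hvT, if_true, Set.mem_Iic]; exact this.2 hvT
      · simp only [hvT, if_false, Set.mem_Ioi]
        by_contra hc
        exact hvT (this.1 (not_lt.1 hc))
  have hset : {ω : Site → ℝ | E {v | ω v ≤ 1 / 2}} =
      ⋃ T ∈ Λ.powerset.filter (fun T : Finset Site => E (T : Set Site)),
        ⋂ v ∈ Λ, (fun ω : Site → ℝ => ω v) ⁻¹'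
          (if v ∈ T then Set.Iic (1 / 2) else Set.Ioi (1 / 2)) := by
    ext ω
    rw [Set.mem_iUnion₂]
    simp only [Set.mem_ofPred_eq, Finset.mem_filter, Finset.mem_powerset, exists_prop]
    rw [hE]
    constructor
    · intro h
      refine ⟨Λ.filter (fun v => ω v ≤ 1 / 2), ⟨Finset.filter_subset _ _, ?_⟩, ?_⟩
      · have e : ((Λ.filter (fun v => ω v ≤ 1 / 2) : Finset Site) : Set Site)
            = {v | ω v ≤ 1 / 2} ∩ ↑Λ := by
          ext v; simp [and_comm]
        rw [e]; exact h
      · rw [hmem _ (Finset.filter_subset _ _)]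
        ext v; simp [and_comm]
    · rintro ⟨T, ⟨hT, hET⟩, hω⟩
      rw [(hmem T hT ω).1 hω]; exact hET
  unfold Pr
  rw [hset, measure_biUnion_finset]
  · simp only [atom_eq hμ, Finset.sum_const, nsmul_eq_mul, ENNReal.toReal_mul,
      ENNReal.toReal_natCast, ENNReal.toReal_pow]
    rw [ENNReal.toReal_ofReal (by norm_num)]
    rw [one_div, inv_pow]; rfl
  · intro T hT T' hT' hne
    rw [Function.onFun, Set.disjoint_left]
    intro ω h1 h2
    simp only [Finset.coe_filter, Finset.mem_powerset, Set.mem_ofPred_eq] at hT hT'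
    rw [hmem T hT.1] at h1
    rw [hmem T' hT'.1] at h2
    exact hne (Finset.coe_injective (h1.symm.trans h2))
  · intro T _
    refine Finset.measurableSet_biInter _ (fun v _ => ?_)
    refine measurable_pi_apply v ?_
    by_cases h : v ∈ T
    · simp only [h, if_true]; exact measurableSet_Iic
    · simp only [h, if_false]; exact measurableSet_Ioi

theorem Pr_nonneg {μ : Measure (Site → ℝ)} (E : Set Site → Prop) : 0 ≤ Pr μ E :=
  ENNReal.toReal_nonneg

theorem Pr_mono {μ : Measure (Site → ℝ)} (hμ : IsUniformCoupling μ) {E E' : Set Site → Prop}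
    (h : ∀ S, E S → E' S) : Pr μ E ≤ Pr μ E' := by
  have := hμ.1
  exact ENNReal.toReal_mono (measure_ne_top _ _) (measure_mono (fun ω hω => h _ hω))

theorem Pr_congr {μ : Measure (Site → ℝ)} {E E' : Set Site → Prop}
    (h : ∀ S, E S ↔ E' S) : Pr μ E = Pr μ E' := by
  have : E = E' := funext fun S => propext (h S)
  rw [this]

theorem Pr_le_one {μ : Measure (Site → ℝ)} (hμ : IsUniformCoupling μ) (E : Set Site → Prop) :
    Pr μ E ≤ 1 := by
  have := hμ.1
  have : Pr μ E ≤ (μ Set.univ).toReal :=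
    ENNReal.toReal_mono (measure_ne_top _ _) (measure_mono (Set.subset_univ _))
  simpa using this

theorem Pr_or {μ : Measure (Site → ℝ)} (hμ : IsUniformCoupling μ) (E E' : Set Site → Prop) :
    Pr μ (fun S => E S ∨ E' S) ≤ Pr μ E + Pr μ E' := by
  have := hμ.1
  unfold Pr
  rw [← ENNReal.toReal_add (measure_ne_top _ _) (measure_ne_top _ _)]
  exact ENNReal.toReal_mono (by finiteness)
    (measure_union_le {ω : Site → ℝ | E {v | ω v ≤ 1 / 2}} {ω | E' {v | ω v ≤ 1 / 2}})

theorem Pr_exists {μ : Measure (Site → ℝ)} (hμ : IsUniformCoupling μ) {ι : Type*} (I : Finset ι)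
    (E : ι → Set Site → Prop) :
    Pr μ (fun S => ∃ i ∈ I, E i S) ≤ ∑ i ∈ I, Pr μ (E i) := by
  classical
  induction I using Finset.induction_on with
  | empty => simp [Pr]
  | insert a I ha ih =>
    rw [Finset.sum_insert ha]
    refine le_trans ?_ (le_trans (Pr_or hμ (E a) (fun S => ∃ i ∈ I, E i S)) (by linarith))
    refine Pr_mono hμ ?_
    rintro S ⟨i, hi, h⟩
    rcases Finset.mem_insert.1 hi with rfl | hi
    · exact Or.inl h
    · exact Or.inr ⟨i, hi, h⟩

theorem Pr_not {μ : Measure (Site → ℝ)} (hμ : IsUniformCoupling μ) {Λ : Finset Site}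
    {E : Set Site → Prop} (hE : DepOn Λ E) : Pr μ (fun S => ¬ E S) = 1 - Pr μ E := by
  classical
  have hE' : DepOn Λ (fun S => ¬ E S) := fun S => not_congr (hE S)
  rw [Pr_eq hμ hE, Pr_eq hμ hE', eq_sub_iff_add_eq, ← add_div, div_eq_one_iff_eq (by positivity)]
  have := Finset.card_filter_add_card_filter_not (s := Λ.powerset)
    (p := fun T : Finset Site => E (T : Set Site))
  rw [Finset.card_powerset] at this
  have h2 : (((Λ.powerset.filter (fun T : Finset Site => E (T : Set Site))).card
    + (Λ.powerset.filter (fun T : Finset Site => ¬ E (T : Set Site))).card : ℕ) : ℝ)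
      = ((2 ^ Λ.card : ℕ) : ℝ) := by rw [this]
  push_cast at h2
  linarith

theorem Pr_flip {μ : Measure (Site → ℝ)} (hμ : IsUniformCoupling μ) {Λ : Finset Site}
    {E : Set Site → Prop} (hE : DepOn Λ E) : Pr μ (fun S => E Sᶜ) = Pr μ E := by
  classical
  have hE' : DepOn Λ (fun S => E Sᶜ) := by
    intro S
    show E Sᶜ ↔ E (S ∩ ↑Λ)ᶜ
    rw [hE Sᶜ, hE (S ∩ ↑Λ)ᶜ]
    have : Sᶜ ∩ (Λ : Set Site) = (S ∩ ↑Λ)ᶜ ∩ ↑Λ := by ext v; simp; tauto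
    rw [this]
  have key : ∀ T : Finset Site, T ⊆ Λ → (E (T : Set Site)ᶜ ↔ E ((Λ \ T : Finset Site) : Set Site)) := by
    intro T hT
    rw [hE]
    have : (T : Set Site)ᶜ ∩ (Λ : Set Site) = ((Λ \ T : Finset Site) : Set Site) := by
      ext v; simp [and_comm]
    rw [this]
  rw [Pr_eq hμ hE, Pr_eq hμ hE']
  congr 2
  refine Finset.card_bij' (fun T _ => Λ \ T) (fun T _ => Λ \ T) ?_ ?_ ?_ ?_
  · intro T hT
    simp only [Finset.mem_filter, Finset.mem_powerset] at hT ⊢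
    exact ⟨Finset.sdiff_subset, (key T hT.1).1 hT.2⟩
  · intro T hT
    simp only [Finset.mem_filter, Finset.mem_powerset] at hT ⊢
    refine ⟨Finset.sdiff_subset, (key _ Finset.sdiff_subset).2 ?_⟩
    rw [Finset.sdiff_sdiff_eq_self hT.1]; exact hT.2
  · intro T hT
    simp only [Finset.mem_filter, Finset.mem_powerset] at hT
    exact Finset.sdiff_sdiff_eq_self hT.1
  · intro T hT
    simp only [Finset.mem_filter, Finset.mem_powerset] at hT
    exact Finset.sdiff_sdiff_eq_self hT.1

theorem Pr_symm {μ : Measure (Site → ℝ)} (hμ : IsUniformCoupling μ) {Λ : Finset Site}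
    {E : Set Site → Prop} (hE : DepOn Λ E) (σ : Site ≃ Site) :
    Pr μ (fun S => E (σ ⁻¹' S)) = Pr μ E := by
  classical
  have hE' : DepOn (Λ.map σ.toEmbedding) (fun S => E (σ ⁻¹' S)) := by
    intro S
    show E (σ ⁻¹' S) ↔ E (σ ⁻¹' (S ∩ ↑(Λ.map σ.toEmbedding)))
    rw [hE, hE (σ ⁻¹' (S ∩ ↑(Λ.map σ.toEmbedding)))]
    have : σ ⁻¹' S ∩ (Λ : Set Site) = σ ⁻¹' (S ∩ ↑(Λ.map σ.toEmbedding)) ∩ ↑Λ := by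
      ext v; simp
    rw [this]
  rw [Pr_eq hμ hE, Pr_eq hμ hE', Finset.card_map]
  congr 2
  refine Finset.card_bij' (fun T _ => T.map σ.symm.toEmbedding) (fun T _ => T.map σ.toEmbedding)
    ?_ ?_ ?_ ?_
  · intro T hT
    simp only [Finset.mem_filter, Finset.mem_powerset] at hT ⊢
    refine ⟨?_, ?_⟩
    · intro v hv
      simp only [Finset.mem_map_equiv, Equiv.symm_symm] at hv
      have := hT.1 hv
      simpa using this
    · have : ((T.map σ.symm.toEmbedding : Finset Site) : Set Site) = σ ⁻¹' (T : Set Site) := by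
        ext v; simp [Finset.mem_map_equiv]
      rw [this]; exact hT.2
  · intro T hT
    simp only [Finset.mem_filter, Finset.mem_powerset] at hT ⊢
    refine ⟨Finset.map_subset_map.2 hT.1, ?_⟩
    have : σ ⁻¹' ((T.map σ.toEmbedding : Finset Site) : Set Site) = (T : Set Site) := by
      ext v; simp
    rw [this]; exact hT.2
  · intro T _
    ext v; simp [Finset.mem_map_equiv]
  · intro T _
    ext v; simp [Finset.mem_map_equiv]

/-- Increasing local events. -/
def Inc (E : Set Site → Prop) : Prop :=
  (∃ Λ : Finset Site, DepOn Λ E) ∧ ∀ S S' : Set Site, S ⊆ S' → E S → E S'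

theorem Inc.and {E E' : Set Site → Prop} (h : Inc E) (h' : Inc E') :
    Inc (fun S => E S ∧ E' S) := by
  classical
  obtain ⟨⟨Λ, hΛ⟩, hm⟩ := h
  obtain ⟨⟨Λ', hΛ'⟩, hm'⟩ := h'
  refine ⟨⟨Λ ∪ Λ', fun S => ?_⟩, fun S S' hS h => ⟨hm _ _ hS h.1, hm' _ _ hS h.2⟩⟩
  exact and_congr (hΛ.mono Finset.subset_union_left S) (hΛ'.mono Finset.subset_union_right S)

theorem Pr_fkg {μ : Measure (Site → ℝ)} (hμ : IsUniformCoupling μ) {E E' : Set Site → Prop}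
    (h : Inc E) (h' : Inc E') : Pr μ E * Pr μ E' ≤ Pr μ (fun S => E S ∧ E' S) := by
  classical
  obtain ⟨⟨Λ₁, d1⟩, hm⟩ := h
  obtain ⟨⟨Λ₂, d2⟩, hm'⟩ := h'
  set Λ := Λ₁ ∪ Λ₂ with hΛ
  have d1 : DepOn Λ E := d1.mono Finset.subset_union_left
  have d2 : DepOn Λ E' := d2.mono Finset.subset_union_right
  have d3 : DepOn Λ (fun S => E S ∧ E' S) := fun S => and_congr (d1 S) (d2 S)
  -- pass to decreasing events by flipping the colours
  rw [← Pr_flip hμ d1, ← Pr_flip hμ d2, ← Pr_flip hμ d3]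
  have f1 : DepOn Λ (fun S => E Sᶜ) := by
    intro S
    show E Sᶜ ↔ E (S ∩ ↑Λ)ᶜ
    rw [d1 Sᶜ, d1 (S ∩ ↑Λ)ᶜ]
    have : Sᶜ ∩ (Λ : Set Site) = (S ∩ ↑Λ)ᶜ ∩ ↑Λ := by ext v; simp; tauto
    rw [this]
  have f2 : DepOn Λ (fun S => E' Sᶜ) := by
    intro S
    show E' Sᶜ ↔ E' (S ∩ ↑Λ)ᶜ
    rw [d2 Sᶜ, d2 (S ∩ ↑Λ)ᶜ]
    have : Sᶜ ∩ (Λ : Set Site) = (S ∩ ↑Λ)ᶜ ∩ ↑Λ := by ext v; simp; tauto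
    rw [this]
  have f3 : DepOn Λ (fun S => E Sᶜ ∧ E' Sᶜ) := fun S => and_congr (f1 S) (f2 S)
  rw [Pr_eq hμ f1, Pr_eq hμ f2, Pr_eq hμ f3]
  have hk := IsLowerSet.le_card_inter_finset'
    (𝒜 := Λ.powerset.filter (fun T : Finset Site => E (T : Set Site)ᶜ))
    (ℬ := Λ.powerset.filter (fun T : Finset Site => E' (T : Set Site)ᶜ)) (s := Λ)
    (by
      intro T T' hT h
      simp only [Finset.coe_filter, Finset.mem_powerset, Set.mem_ofPred_eq] at h ⊢
      exact ⟨hT.trans h.1, hm _ _ (Set.compl_subset_compl.2 (Finset.coe_subset.2 hT)) h.2⟩)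
    (by
      intro T T' hT h
      simp only [Finset.coe_filter, Finset.mem_powerset, Set.mem_ofPred_eq] at h ⊢
      exact ⟨hT.trans h.1, hm' _ _ (Set.compl_subset_compl.2 (Finset.coe_subset.2 hT)) h.2⟩)
    (fun T hT => Finset.mem_powerset.1 (Finset.mem_filter.1 hT).1)
    (fun T hT => Finset.mem_powerset.1 (Finset.mem_filter.1 hT).1)
  rw [← Finset.filter_and] at hk
  have hk' : ((Λ.powerset.filter (fun T : Finset Site => E (T : Set Site)ᶜ)).card : ℝ) *
      ((Λ.powerset.filter (fun T : Finset Site => E' (T : Set Site)ᶜ)).card : ℝ) ≤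
      2 ^ Λ.card * ((Λ.powerset.filter (fun T : Finset Site => E (T : Set Site)ᶜ ∧ E' (T : Set Site)ᶜ)).card : ℝ) := by
    exact_mod_cast hk
  rw [div_mul_div_comm, div_le_div_iff₀ (by positivity) (by positivity)]
  nlinarith [pow_pos (two_pos : (0 : ℝ) < 2) Λ.card]

theorem Pr_indep {μ : Measure (Site → ℝ)} (hμ : IsUniformCoupling μ) {E E' : Set Site → Prop}
    {Λ Λ' : Finset Site} (h : DepOn Λ E) (h' : DepOn Λ' E') (hd : Disjoint Λ Λ') :
    Pr μ (fun S => E S ∧ E' S) = Pr μ E * Pr μ E' := by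
  classical
  have d3 : DepOn (Λ ∪ Λ') (fun S => E S ∧ E' S) := fun S =>
    and_congr (h.mono Finset.subset_union_left S) (h'.mono Finset.subset_union_right S)
  rw [Pr_eq hμ h, Pr_eq hμ h', Pr_eq hμ d3, div_mul_div_comm, ← pow_add,
    Finset.card_union_of_disjoint hd]
  congr 1
  rw [← Nat.cast_mul, ← Finset.card_product]
  congr 1
  have dis : ∀ v ∈ Λ, v ∉ Λ' := fun v h1 h2 => Finset.disjoint_left.1 hd h1 h2
  refine Finset.card_bij' (fun T _ => (T ∩ Λ, T ∩ Λ')) (fun T _ => T.1 ∪ T.2) ?_ ?_ ?_ ?_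
  · intro T hT
    simp only [Finset.mem_filter, Finset.mem_powerset, Finset.mem_product] at hT ⊢
    refine ⟨⟨Finset.inter_subset_right, ?_⟩, Finset.inter_subset_right, ?_⟩
    · rw [Finset.coe_inter, ← h]; exact hT.2.1
    · rw [Finset.coe_inter, ← h']; exact hT.2.2
  · rintro ⟨T, T'⟩ hT
    simp only [Finset.mem_filter, Finset.mem_powerset, Finset.mem_product] at hT ⊢
    obtain ⟨⟨h1, h2⟩, h3, h4⟩ := hT
    refine ⟨Finset.union_subset_union h1 h3, ?_, ?_⟩
    · rw [h]
      have : ((T ∪ T' : Finset Site) : Set Site) ∩ (Λ : Set Site) = T := by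
        ext v
        simp only [Finset.coe_union, Set.mem_inter_iff, Set.mem_union, Finset.mem_coe]
        constructor
        · rintro ⟨a | a, b⟩
          · exact a
          · exact absurd (h3 a) (dis v b)
        · intro a; exact ⟨Or.inl a, h1 a⟩
      rw [this]; exact h2
    · rw [h']
      have : ((T ∪ T' : Finset Site) : Set Site) ∩ (Λ' : Set Site) = T' := by
        ext v
        simp only [Finset.coe_union, Set.mem_inter_iff, Set.mem_union, Finset.mem_coe]
        constructor
        · rintro ⟨a | a, b⟩
          · exact absurd b (dis v (h1 a))
          · exact a
        · intro a; exact ⟨Or.inr a, h3 a⟩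
      rw [this]; exact h4
  · intro T hT
    simp only [Finset.mem_filter, Finset.mem_powerset] at hT
    rw [← Finset.inter_union_distrib_left]
    exact Finset.inter_eq_left.2 hT.1
  · rintro ⟨T, T'⟩ hT
    simp only [Finset.mem_filter, Finset.mem_powerset, Finset.mem_product] at hT
    obtain ⟨⟨h1, h2⟩, h3, h4⟩ := hT
    ext v
    · simp only [Finset.mem_inter, Finset.mem_union]
      constructor
      · rintro ⟨a | a, b⟩
        · exact a
        · exact absurd (h3 a) (dis v b)
      · intro a; exact ⟨Or.inl a, h1 a⟩
    · simp only [Finset.mem_inter, Finset.mem_union]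
      constructor
      · rintro ⟨a | a, b⟩
        · exact absurd b (dis v (h1 a))
        · exact a
      · intro a; exact ⟨Or.inr a, h3 a⟩

/-- Comparison through an involution. -/
theorem Pr_invol {μ : Measure (Site → ℝ)} (hμ : IsUniformCoupling μ) {G E : Set Site → Prop}
    {Λ : Finset Site} (hG : DepOn Λ G) (hE : DepOn Λ E) (Φ : Set Site → Set Site)
    (h1 : ∀ S, G S → S ⊆ ↑Λ → G (Φ S) ∧ Φ S ⊆ ↑Λ ∧ Φ (Φ S) = S)
    (h2 : ∀ S, G S → S ⊆ ↑Λ → E S ∨ E (Φ S)) : Pr μ G ≤ 2 * Pr μ E := by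
  classical
  rw [Pr_eq hμ hG, Pr_eq hμ hE, ← mul_div_assoc]
  gcongr
  set g := Λ.powerset.filter (fun T : Finset Site => G (T : Set Site))
  set e := Λ.powerset.filter (fun T : Finset Site => E (T : Set Site))
  have a1 : g.card ≤ (g.filter (fun T : Finset Site => E (T : Set Site))).card
      + (g.filter (fun T : Finset Site => E (Φ (T : Set Site)))).card := by
    have : g ⊆ g.filter (fun T : Finset Site => E (T : Set Site)) ∪ g.filter (fun T : Finset Site => E (Φ (T : Set Site))) := by
      intro T hT
      have hT' := hT
      simp only [g, Finset.mem_filter, Finset.mem_powerset] at hT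
      rcases h2 T hT.2 (Finset.coe_subset.2 hT.1) with h | h
      · exact Finset.mem_union_left _ (Finset.mem_filter.2 ⟨hT', h⟩)
      · exact Finset.mem_union_right _ (Finset.mem_filter.2 ⟨hT', h⟩)
    exact (Finset.card_le_card this).trans (Finset.card_union_le _ _)
  have a2 : (g.filter (fun T : Finset Site => E (T : Set Site))).card ≤ e.card := by
    refine Finset.card_le_card (fun T hT => ?_)
    simp only [g, e, Finset.mem_filter] at hT ⊢
    exact ⟨hT.1.1, hT.2⟩
  have fin : ∀ X : Set Site, X ⊆ ↑Λ → ((Λ.filter (fun v => v ∈ X) : Finset Site) : Set Site) = X := by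
    intro X hX
    ext v
    simp only [Finset.coe_filter, Set.mem_ofPred_eq]
    exact ⟨fun h => h.2, fun h => ⟨hX h, h⟩⟩
  have a3 : (g.filter (fun T : Finset Site => E (Φ (T : Set Site)))).card ≤ e.card := by
    refine Finset.card_le_card_of_injOn (fun T => Λ.filter (fun v => v ∈ Φ (T : Set Site))) ?_ ?_
    · intro T hT
      simp only [g, Finset.coe_filter, Finset.mem_filter, Finset.mem_powerset,
        Set.mem_ofPred_eq] at hT
      have := h1 T hT.1.2 (Finset.coe_subset.2 hT.1.1)
      simp only [e, Finset.coe_filter, Finset.mem_powerset, Set.mem_ofPred_eq]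
      refine ⟨Finset.filter_subset _ _, ?_⟩
      have e2 := fin _ this.2.1
      simp only [Finset.coe_filter] at e2
      rw [e2]; exact hT.2
    · intro T hT T' hT' hTT
      simp only [g, Finset.coe_filter, Finset.mem_filter, Finset.mem_powerset,
        Set.mem_ofPred_eq] at hT hT'
      have e1 := h1 T hT.1.2 (Finset.coe_subset.2 hT.1.1)
      have e2 := h1 T' hT'.1.2 (Finset.coe_subset.2 hT'.1.1)
      have := congrArg (fun X : Finset Site => (X : Set Site)) hTT
      simp only at this
      rw [fin _ e1.2.1, fin _ e2.2.1] at this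
      have h3 := congrArg Φ this
      rw [e1.2.2, e2.2.2] at h3
      exact Finset.coe_injective h3
  have : g.card ≤ 2 * e.card := by omega
  exact_mod_cast this

/-! ### Crossing events -/

theorem Cx_dep {R : Set Site} (hR : R.Finite) (a b : Set Site) : DepOn hR.toFinset (Cx R a b) := by
  intro S
  unfold Cx
  simp only [Set.Finite.coe_toFinset, Set.inter_assoc, Set.inter_self]

theorem Cx_mono {R R' a a' b b' S S' : Set Site} (hR : R ⊆ R') (ha : a ⊆ a') (hb : b ⊆ b')
    (hS : S ⊆ S') (h : Cx R a b S) : Cx R' a' b' S' := by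
  obtain ⟨u, v, hu, hv, h⟩ := h
  exact ⟨u, v, ha hu, hb hv, h.mono (Set.inter_subset_inter hS hR)⟩

theorem Cx_inc {R : Set Site} (hR : R.Finite) (a b : Set Site) : Inc (Cx R a b) :=
  ⟨⟨_, Cx_dep hR a b⟩, fun _ _ hS h => Cx_mono le_rfl le_rfl le_rfl hS h⟩

theorem Cx_map {μ : Measure (Site → ℝ)} (hμ : IsUniformCoupling μ) {R a b R' a' b' : Set Site}
    (hR : R.Finite) (σ : Site ≃ Site) (hσ : ∀ u v, HA u v → HA (σ u) (σ v))
    (h1 : ∀ v ∈ R, σ v ∈ R') (h2 : ∀ v ∈ a, v ∈ R → σ v ∈ a') (h3 : ∀ v ∈ b, v ∈ R → σ v ∈ b') :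
    Pr μ (Cx R a b) ≤ Pr μ (Cx R' a' b') := by
  rw [← Pr_symm hμ (Cx_dep hR a b) σ]
  refine Pr_mono hμ ?_
  rintro S ⟨u, v, hu, hv, h⟩
  exact ⟨σ u, σ v, h2 _ hu h.left.2, h3 _ hv h.right.2,
    h.map σ hσ (fun w hw => ⟨hw.1, h1 _ hw.2⟩)⟩

theorem Rect_finite (x0 x1 y0 y1 : ℤ) : (Rect x0 x1 y0 y1).Finite := by
  refine (Set.finite_Icc ((x0, y0) : ℤ × ℤ) (x1, y1)).subset ?_
  rintro ⟨x, y⟩ h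
  rw [mem_Rect] at h
  exact ⟨⟨h.1, h.2.2.1⟩, ⟨h.2.1, h.2.2.2⟩⟩


/-! ### The chevron -/

/-- The reflection fixing the column `x = 0`. -/
def sig : Site ≃ Site where
  toFun v := (-v.1, v.2 + v.1)
  invFun v := (-v.1, v.2 + v.1)
  left_inv v := by ext <;> simp
  right_inv v := by ext <;> simp

theorem sig_fst (v : Site) : (sig v).1 = -v.1 := rfl
theorem sig_snd (v : Site) : (sig v).2 = v.2 + v.1 := rfl
theorem sig_sig (v : Site) : sig (sig v) = v := by ext <;> simp [sig_fst, sig_snd]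
theorem sig_HA (u v : Site) (h : HA u v) : HA (sig u) (sig v) := by
  unfold HA at *; simp only [sig_fst, sig_snd]; omega
theorem sig_zero {v : Site} (h : v.1 = 0) : sig v = v := by
  ext <;> simp [sig_fst, sig_snd, h]

/-- The left half of the chevron. -/
def chA (n : ℤ) : Set Site := Rect (-n) 0 0 n

theorem mem_chA {n : ℤ} {v : Site} : v ∈ chA n ↔ -n ≤ v.1 ∧ v.1 ≤ 0 ∧ 0 ≤ v.2 ∧ v.2 ≤ n := Iff.rfl

/-- The chevron. -/
def chC (n : ℤ) : Set Site :=
  {v | -n ≤ v.1 ∧ v.1 ≤ n ∧ 0 ≤ v.2 + v.1 + (if v.1 ≤ 0 then -v.1 else 0) ∧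
    v.2 + v.1 + (if v.1 ≤ 0 then -v.1 else 0) ≤ n}

theorem mem_chC {n : ℤ} {v : Site} : v ∈ chC n ↔ -n ≤ v.1 ∧ v.1 ≤ n ∧
    ((v.1 ≤ 0 ∧ 0 ≤ v.2 ∧ v.2 ≤ n) ∨ (0 < v.1 ∧ 0 ≤ v.2 + v.1 ∧ v.2 + v.1 ≤ n)) := by
  unfold chC
  simp only [Set.mem_ofPred_eq]
  split_ifs <;> omega

theorem chA_sub {n : ℤ} (hn : 0 ≤ n) : chA n ⊆ chC n := by
  intro v hv
  rw [mem_chA] at hv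
  rw [mem_chC]
  omega

theorem sig_chC {n : ℤ} {v : Site} (h : v ∈ chC n) : sig v ∈ chC n := by
  rw [mem_chC] at *
  rw [sig_fst, sig_snd]
  omega

theorem chC_finite (n : ℤ) : (chC n).Finite := by
  refine (Rect_finite (-n) n (-n) n).subset ?_
  intro v hv
  rw [mem_chC] at hv
  rw [mem_Rect]
  omega

def W0 (n : ℤ) (S : Set Site) : Set Site := {v | ∃ u : Site, u.2 = 0 ∧ Cn (Sᶜ ∩ chA n) u v}
def WW (n : ℤ) (S : Set Site) : Set Site := {v | (v.1 ≤ 0 ∧ v.2 ≤ -1) ∨ v ∈ W0 n S}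
def NN (n : ℤ) (S : Set Site) : Set Site := {v | v.1 ≤ 0 ∧ v ∉ WW n S}
def BB (n : ℤ) (S : Set Site) : Set Site := {v | Cn (NN n S) (-n - 1, 0) v}
def ad (n : ℤ) (S : Set Site) (v : Site) : Prop := ∃ w ∈ WW n S, HA v w
/-- No white crossing of the left half. -/
def GG (n : ℤ) (S : Set Site) : Prop := ∀ v ∈ W0 n S, v.2 ≠ n

theorem W0_right {n : ℤ} {S : Set Site} {v : Site} (h : v ∈ W0 n S) : v ∉ S ∧ v ∈ chA n := by
  obtain ⟨u, _, h⟩ := h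
  exact ⟨h.right.1, h.right.2⟩

theorem WW_le {n : ℤ} {S : Set Site} {v : Site} (h : v ∈ WW n S) : v.1 ≤ 0 := by
  rcases h with h | h
  · exact h.1
  · exact (mem_chA.1 (W0_right h).2).2.1

theorem WW_lt {n : ℤ} {S : Set Site} (hG : GG n S) (hn : 0 ≤ n) {v : Site} (h : v ∈ WW n S) :
    v.2 < n := by
  rcases h with h | h
  · omega
  · have := hG v h
    have := mem_chA.1 (W0_right h).2
    omega

theorem ad_black {n : ℤ} {S : Set Site} {v : Site} (hv : v ∈ chA n) (hW : v ∉ WW n S)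
    (ha : ad n S v) : v ∈ S := by
  by_contra hS
  obtain ⟨w, hw, hvw⟩ := ha
  refine hW (Or.inr ?_)
  rcases hw with hw | ⟨u, hu, hw⟩
  · have := hvw.bounds
    have h2 := mem_chA.1 hv
    exact ⟨v, by omega, Cn.refl ⟨hS, hv⟩⟩
  · exact ⟨u, hu, hw.tail hvw.symm ⟨hS, hv⟩⟩

theorem NN_nonneg {n : ℤ} {S : Set Site} {v : Site} (h : v ∈ NN n S) : v.1 ≤ 0 ∧ 0 ≤ v.2 := by
  refine ⟨h.1, ?_⟩
  by_contra hc
  exact h.2 (Or.inl ⟨h.1, by omega⟩)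

theorem BB_NN {n : ℤ} {S : Set Site} {v : Site} (h : v ∈ BB n S) : v ∈ NN n S := h.right

theorem left_NN {n : ℤ} (hn : 0 ≤ n) {S : Set Site} {v : Site} (h : v.1 < -n) (h2 : 0 ≤ v.2) :
    v ∈ NN n S := by
  refine ⟨by omega, ?_⟩
  rintro (hc | hc)
  · omega
  · have := mem_chA.1 (W0_right hc).2
    omega

theorem left_BB {n : ℤ} (hn : 0 ≤ n) {S : Set Site} {v : Site} (h : v.1 < -n) (h2 : 0 ≤ v.2) :
    v ∈ BB n S := by
  have c1 : Cn (NN n S) (-n - 1, 0) (-n - 1, v.2) :=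
    Cn.vert _ h2 (fun y h3 h4 => left_NN hn (by simp) h3)
  have c2 : Cn (NN n S) (v.1, v.2) (-n - 1, v.2) :=
    Cn.horiz _ (by omega) (fun x h3 h4 => left_NN hn (by simp; omega) h2)
  exact c1.trans c2.symm

theorem top_NN {n : ℤ} (hn : 0 ≤ n) {S : Set Site} (hG : GG n S) {v : Site} (h : v.1 ≤ 0)
    (h2 : n ≤ v.2) : v ∈ NN n S := by
  refine ⟨h, fun hc => ?_⟩
  have := WW_lt hG hn hc
  omega

theorem top_BB {n : ℤ} (hn : 0 ≤ n) {S : Set Site} (hG : GG n S) {v : Site} (h : v.1 ≤ 0)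
    (h2 : n ≤ v.2) : v ∈ BB n S := by
  by_cases h3 : v.1 < -n
  · exact left_BB hn h3 (by omega)
  · have c1 : Cn (NN n S) (-n - 1, 0) (-n - 1, v.2) := left_BB hn (by simp) (by simp; omega)
    have c2 : Cn (NN n S) (-n - 1, v.2) (v.1, v.2) :=
      Cn.horiz _ (by omega) (fun x h3 h4 => top_NN hn hG (by simp; omega) h2)
    exact c1.trans c2

/-- A neighbour of `BB` in the left half plane outside `BB` lies in `WW`. -/
theorem nb_WW {n : ℤ} {S : Set Site} {a b : Site} (hb : b ∈ BB n S) (ha : a ∉ BB n S)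
    (ha1 : a.1 ≤ 0) (hab : HA b a) : a ∈ WW n S := by
  by_contra hc
  exact ha (Cn.tail hb hab ⟨ha1, hc⟩)

/-- The boundary of the white part is connected to the left side. -/
theorem lemT {n : ℤ} (hn : 0 ≤ n) {S : Set Site} (hG : GG n S) {v : Site} (hA : v ∈ chA n)
    (hB : v ∈ BB n S) (ha : ad n S v) : ∃ u : Site, u.1 = -n ∧ Cn (S ∩ chA n) u v := by
  set D : Set Site := {v | v ∈ NN n S ∧ ad n S v} with hD
  set A1 : Set Site := {v | Cn D (-n - 1, 0) v} with hA1
  obtain ⟨g, hg⟩ := parity 0 A1 (WW n S) (fun v h => (Cn.right h).1.2) (by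
    intro a ha w hw c haw hac hwc _ _ hc
    by_cases hcW : c ∈ WW n S
    · exact Or.inr hcW
    · exact Or.inl (Cn.tail ha hac ⟨⟨hc, hcW⟩, w, hw, hwc.symm⟩))
  have base : ((-n - 1, -1) : Site) ∈ WW n S := Or.inl ⟨by simp; omega, by simp⟩
  have v0N : ((-n - 1, 0) : Site) ∈ NN n S := left_NN hn (by simp) (by simp)
  have v0A : ((-n - 1, 0) : Site) ∈ A1 :=
    Cn.refl ⟨v0N, _, base, by simp [HA]⟩
  -- the function is constant on the white part
  have pad : ∀ w : Site, w.1 ≤ 0 → w.2 ≤ -1 → Cn (WW n S) w (-n - 1, -1) := by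
    intro w h1 h2
    have c1 : Cn (WW n S) (w.1, w.2) (w.1, -1) :=
      Cn.vert _ h2 (fun y h3 h4 => Or.inl ⟨h1, h4⟩)
    refine c1.trans ?_
    rcases le_total w.1 (-n - 1) with h | h
    · exact Cn.horiz _ h (fun x h3 h4 => Or.inl ⟨by simp; omega, by simp⟩)
    · exact (Cn.horiz _ h (fun x h3 h4 => Or.inl ⟨by simp; omega, by simp⟩)).symm
  have conW : ∀ w ∈ WW n S, Cn (WW n S) w (-n - 1, -1) := by
    intro w hw
    rcases hw with hw | ⟨u, hu, hw⟩
    · exact pad w hw.1 hw.2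
    · have c1 : Cn (WW n S) u w := by
        refine hw.ind (fun a => Cn (WW n S) u a)
          (Cn.refl (Or.inr ⟨u, hu, Cn.refl hw.left⟩)) ?_
        intro a b ha ih hab hb
        exact ih.tail hab (Or.inr ⟨u, hu, ha.tail hab hb⟩)
      have hu' := mem_chA.1 hw.left.2
      have c2 : Cn (WW n S) u (u.1, -1) :=
        Cn.step c1.left (by simp [HA, hu]) (Or.inl ⟨hu'.2.1, by simp⟩)
      exact (c1.symm.trans c2).trans (pad _ hu'.2.1 (by simp))
  have gW : ∀ w ∈ WW n S, g w = g (-n - 1, -1) := fun w hw =>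
    g_const hg (conW w hw) (fun w h => WW_le h) (Or.inl (fun w h h' => (Cn.right h').1.2 h))
  have gB : ∀ w ∈ BB n S, g (-n - 1, 0) = g w := fun w hw =>
    g_const hg hw (fun w h => h.1) (Or.inr (fun w h => h.2))
  have e0 := hg (-n - 1, 0) (-n - 1, -1) (by simp [HA]) (by simp; omega) (by simp; omega)
  have ne : g (-n - 1, 0) ≠ g (-n - 1, -1) := fun h => e0.1 h (Or.inl ⟨v0A, base⟩)
  obtain ⟨w, hw, hvw⟩ := ha
  have vA1 : v ∈ A1 := by
    by_contra hv
    have := (hg v w hvw (BB_NN hB).1 (WW_le hw)).2 (by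
      rintro (h | h)
      · exact hv h.1
      · exact (BB_NN hB).2 h.1)
    rw [← gB v hB, gW w hw] at this
    exact ne this
  obtain ⟨a, b, h1, h2, h3, h4⟩ := Cn.lastExit (show Cn D _ v from vA1) (Y := {w | w.1 < -n})
    (by simp) (by have := mem_chA.1 hA; simp; omega)
  have hb := h4.left.2
  simp only [Set.mem_compl_iff, Set.mem_ofPred_eq, not_lt] at hb h2
  refine ⟨b, by have := h3.bounds; omega, h4.mono ?_⟩
  rintro c ⟨⟨hc1, hc2⟩, hc3⟩
  simp only [Set.mem_compl_iff, Set.mem_ofPred_eq, not_lt] at hc3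
  have hcA : c ∈ chA n := by
    obtain ⟨w', hw', hcw⟩ := hc2
    have := WW_lt hG hn hw'
    have h5 := hcw.bounds
    have h6 := NN_nonneg hc1
    rw [mem_chA]; omega
  exact ⟨ad_black hcA hc1.2 hc2, hcA⟩

/-- Left representative. -/
def lr (v : Site) : Site := if v.1 ≤ 0 then v else sig v

theorem lr_sig (v : Site) : lr (sig v) = lr v := by
  unfold lr
  rw [sig_fst]
  split_ifs with h1 h2 h2
  · exact sig_zero (by omega)
  · rfl
  · exact sig_sig v
  · omega

def UU (n : ℤ) (S : Set Site) : Set Site :=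
  {v | v ∈ chC n ∧ lr v ∈ BB n S ∧ ¬ ad n S (lr v)}

theorem UU_sig {n : ℤ} {S : Set Site} {v : Site} (h : v ∈ UU n S) : sig v ∈ UU n S :=
  ⟨sig_chC h.1, by rw [lr_sig]; exact h.2.1, by rw [lr_sig]; exact h.2.2⟩

/-- Flip and reflect. -/
def Phi (n : ℤ) (S : Set Site) : Set Site :=
  {v | (v ∈ UU n S ∧ sig v ∉ S) ∨ (v ∉ UU n S ∧ v ∈ S)}

theorem W0_Phi (n : ℤ) (S : Set Site) : W0 n (Phi n S) = W0 n S := by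
  have nU1 : ∀ v ∈ chA n, v ∈ WW n S → v ∉ UU n S := by
    intro v hv hW hU
    have := hU.2.1
    unfold lr at this
    rw [if_pos (mem_chA.1 hv).2.1] at this
    exact (BB_NN this).2 hW
  have nU2 : ∀ v ∈ chA n, ad n S v → v ∉ UU n S := by
    intro v hv hW hU
    have := hU.2.2
    unfold lr at this
    rw [if_pos (mem_chA.1 hv).2.1] at this
    exact this hW
  ext v
  constructor
  · rintro ⟨u, hu, h⟩
    refine h.ind (fun a => a ∈ W0 n S) ?_ ?_
    · have huA := h.left.2
      have huU := nU2 u huA ⟨(u.1, -1), Or.inl ⟨(mem_chA.1 huA).2.1, by simp⟩, by simp [HA, hu]⟩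
      refine ⟨u, hu, Cn.refl ⟨fun hc => h.left.1 (Or.inr ⟨huU, hc⟩), huA⟩⟩
    · rintro a b - ⟨u', hu', ha⟩ hab hb
      have hbU := nU2 b hb.2 ⟨a, Or.inr ⟨u', hu', ha⟩, hab.symm⟩
      exact ⟨u', hu', ha.tail hab ⟨fun hc => hb.1 (Or.inr ⟨hbU, hc⟩), hb.2⟩⟩
  · rintro ⟨u, hu, h⟩
    have key : ∀ a, a ∈ W0 n S → a ∈ (Phi n S)ᶜ ∩ chA n := by
      intro a ha
      have h1 := W0_right ha
      refine ⟨?_, h1.2⟩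
      rintro (hc | hc)
      · exact nU1 a h1.2 (Or.inr ha) hc.1
      · exact h1.1 hc.2
    refine ⟨u, hu, h.ind (fun a => Cn _ u a) (Cn.refl (key u ⟨u, hu, Cn.refl h.left⟩)) ?_⟩
    intro a b ha ih hab hb
    exact ih.tail hab (key b ⟨u, hu, ha.tail hab hb⟩)

theorem WW_Phi (n : ℤ) (S : Set Site) : WW n (Phi n S) = WW n S := by unfold WW; rw [W0_Phi]
theorem BB_Phi (n : ℤ) (S : Set Site) : BB n (Phi n S) = BB n S := by
  unfold BB NN; rw [WW_Phi]
theorem ad_Phi (n : ℤ) (S : Set Site) : ad n (Phi n S) = ad n S := by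
  unfold ad; rw [WW_Phi]
theorem UU_Phi (n : ℤ) (S : Set Site) : UU n (Phi n S) = UU n S := by
  unfold UU; rw [BB_Phi, ad_Phi]
theorem GG_Phi {n : ℤ} {S : Set Site} (h : GG n S) : GG n (Phi n S) := by
  unfold GG; rw [W0_Phi]; exact h

theorem Phi_Phi (n : ℤ) (S : Set Site) : Phi n (Phi n S) = S := by
  ext v
  have e : v ∈ Phi n (Phi n S) ↔
    ((v ∈ UU n S ∧ sig v ∉ Phi n S) ∨ (v ∉ UU n S ∧ v ∈ Phi n S)) := by
    have e0 : v ∈ Phi n (Phi n S) ↔ ((v ∈ UU n (Phi n S) ∧ sig v ∉ Phi n S) ∨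
      (v ∉ UU n (Phi n S) ∧ v ∈ Phi n S)) := Iff.rfl
    rw [UU_Phi] at e0
    exact e0
  rw [e]
  by_cases hv : v ∈ UU n S
  · have h2 := UU_sig hv
    have : sig v ∈ Phi n S ↔ v ∉ S := by
      unfold Phi; simp [h2, sig_sig]
    simp [hv, this]
  · have : v ∈ Phi n S ↔ v ∈ S := by
      unfold Phi; simp [hv]
    simp [hv, this]

/-- Target side. -/
def TR (n : ℤ) : Set Site := {v | v.1 = n ∨ (0 ≤ v.1 ∧ v.2 + v.1 = n)}

def E1 (n : ℤ) : Set Site → Prop := Cx (chC n) {v | v.1 = -n} (TR n)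

theorem chev_main {n : ℤ} (hn : 1 ≤ n) {S : Set Site} (hG : GG n S) :
    E1 n S ∨ E1 n (Phi n S) := by
  have hn0 : 0 ≤ n := by omega
  set P : Set Site := {v | (0 ≤ v.1 ∧ n < v.2 + v.1) ∨ (n < v.1 ∧ 0 ≤ v.2 + v.1)} with hP
  set Q : Set Site := {v | (v.1 < -n ∧ 0 ≤ v.2) ∨ (v.1 < 0 ∧ n < v.2)} with hQ
  set K : Set Site := {v | (v.1 ≤ 0 ∧ v ∉ BB n S) ∨ (v ∈ chA n ∧ v ∈ S) ∨
    (1 ≤ v.1 ∧ sig v ∈ BB n S ∧ ¬ ad n S (sig v) ∧ sig v ∈ chA n ∧ v ∈ S) ∨ v ∈ P} with hK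
  by_contra hcon
  rw [not_or] at hcon
  obtain ⟨hno, hno'⟩ := hcon
  -- white vertices
  have wQ : ∀ v ∈ Q, v ∉ K := by
    intro v hv
    have hvB : v ∈ BB n S := by
      rcases hv with hv | hv
      · exact left_BB hn0 hv.1 hv.2
      · exact top_BB hn0 hG hv.1.le hv.2.le
    simp only [hK, hP, hQ, Set.mem_ofPred_eq] at hv ⊢
    rintro (h | h | h | h)
    · exact h.2 hvB
    · have := mem_chA.1 h.1; omega
    · omega
    · omega
  have wV : ∀ v : Site, 1 ≤ v.1 → v.2 + v.1 < 0 → v ∉ K := by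
    intro v h1 h2
    simp only [hK, hP, Set.mem_ofPred_eq]
    rintro (h | h | h | h)
    · omega
    · have := mem_chA.1 h.1; omega
    · have := mem_chA.1 h.2.2.2.1
      rw [sig_fst, sig_snd] at this
      omega
    · omega
  have bZ : ∀ v : Site, v.1 ≤ 0 → v.2 ≤ -1 → v ∉ BB n S := by
    intro v h1 h2 h3
    have := NN_nonneg (BB_NN h3)
    omega
  set A : Set Site := {v | Cn K (0, -1) v} with hA
  set W : Set Site := {v | Cn Kᶜ (1, -2) v} with hW
  -- no black path
  have nP : ∀ v ∈ P, v ∉ A := by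
    intro v hv hvA
    set Y : Set Site := {v | v.1 ≤ 0 ∧ v ∉ BB n S} with hY
    have hvY : v ∉ Y := by
      rintro ⟨h1, h2⟩
      simp only [hP, Set.mem_ofPred_eq] at hv
      exact h2 (top_BB hn0 hG h1 (by omega))
    obtain ⟨a, b, h1, h2, h3, h4⟩ := Cn.lastExit (show Cn K _ v from hvA) (Y := Y)
      ⟨by simp, bZ _ (by simp) (by simp)⟩ hvY
    have hbK := h4.left.1
    have hbY := h4.left.2
    have bd := h3.bounds
    have ha1 : a.1 ≤ 0 := h2.1
    have ha2 : a ∉ BB n S := h2.2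
    have hay : a.2 < n := by
      by_contra hc
      exact ha2 (top_BB hn0 hG ha1 (by omega))
    have hbP : b ∉ P := by
      intro h
      simp only [hP, Set.mem_ofPred_eq] at h
      unfold HA at h3
      omega
    obtain ⟨c, d, k1, k2, k3, k4⟩ := h4.exit (Y := Pᶜ) hbP (by simpa using hv)
    have k4 : d ∈ P := by simpa using k4
    -- the middle segment
    have mid : ∀ w, w ∈ K ∩ Yᶜ ∩ Pᶜ → w ∈ S ∩ chC n := by
      rintro w ⟨⟨w1, w2⟩, w3⟩
      rcases w1 with h | h | h | h
      · exact absurd h w2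
      · exact ⟨h.2, chA_sub hn0 h.1⟩
      · refine ⟨h.2.2.2.2, ?_⟩
        have := sig_chC (chA_sub hn0 h.2.2.2.1)
        rwa [sig_sig] at this
      · exact absurd h w3
    have hcS := mid c k1.right
    have hseg := k1.mono mid
    -- the start
    have hb : ∃ u : Site, u.1 = -n ∧ Cn (S ∩ chA n) u b := by
      rcases hbK with h | h | h | h
      · exact absurd h hbY
      · have hbB : b ∈ BB n S := by
          by_contra hc
          exact hbY ⟨(mem_chA.1 h.1).2.1, hc⟩
        exact lemT hn0 hG h.1 hbB ⟨a, nb_WW hbB ha2 ha1 h3.symm, h3.symm⟩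
      · exfalso
        have ha0 : sig a = a := sig_zero (by omega)
        have := sig_HA _ _ h3.symm
        rw [ha0] at this
        exact h.2.2.1 ⟨a, nb_WW h.2.1 ha2 ha1 this, this⟩
      · exact absurd h hbP
    obtain ⟨u, hu, hub⟩ := hb
    refine hno ⟨u, c, hu, ?_, (hub.mono (Set.inter_subset_inter_right _ (chA_sub hn0))).trans hseg⟩
    have hcC := mem_chC.1 hcS.2
    have hcP : c ∉ P := k1.right.2
    simp only [hP, Set.mem_ofPred_eq] at hcP k4
    simp only [TR, Set.mem_ofPred_eq]
    unfold HA at k2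
    omega
  -- no white path
  have nQ : ∀ v ∈ Q, v ∉ W := by
    intro v hv hvW
    set Y : Set Site := {v | 1 ≤ v.1 ∧ (sig v ∉ BB n S ∨ (ad n S (sig v) ∧ sig v ∈ chA n))} with hY
    have hvY : v ∉ Y := by
      rintro ⟨h1, h2⟩
      simp only [hQ, Set.mem_ofPred_eq] at hv
      omega
    obtain ⟨a, b, h1, h2, h3, h4⟩ := Cn.lastExit (show Cn Kᶜ _ v from hvW) (Y := Y)
      ⟨by simp, Or.inl (bZ _ (by simp [sig_fst]) (by simp [sig_snd]))⟩ hvY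
    have bd := h3.bounds
    have hbQ : b ∉ Q := by
      intro h
      have := h2.1
      simp only [hQ, Set.mem_ofPred_eq] at h
      omega
    obtain ⟨c, d, k1, k2, k3, k4⟩ := h4.exit (Y := Qᶜ) hbQ (by simpa using hv)
    have k4 : d ∈ Q := by simpa using k4
    have mid : ∀ w, w ∈ Kᶜ ∩ Yᶜ ∩ Qᶜ → w ∈ UU n S ∧ w ∉ S := by
      rintro w ⟨⟨w1, w2⟩, w3⟩
      simp only [hK, Set.mem_compl_iff, Set.mem_ofPred_eq, not_or] at w1
      obtain ⟨x1, x2, x3, x4⟩ := w1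
      by_cases hw : w.1 ≤ 0
      · have hwB : w ∈ BB n S := by
          by_contra hc
          exact x1 ⟨hw, hc⟩
        have hwN := NN_nonneg (BB_NN hwB)
        have hwA : w ∈ chA n := by
          rw [mem_chA]
          simp only [hP, hQ, Set.mem_ofPred_eq, Set.mem_compl_iff] at x4 w3
          omega
        have hwS : w ∉ S := fun h => x2 ⟨hwA, h⟩
        refine ⟨⟨chA_sub hn0 hwA, ?_, ?_⟩, hwS⟩
        · unfold lr; rw [if_pos hw]; exact hwB
        · unfold lr; rw [if_pos hw]
          exact fun h => hwS (ad_black hwA (BB_NN hwB).2 h)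
      · have y2 : sig w ∈ BB n S := by
          by_contra hc
          exact w2 ⟨by omega, Or.inl hc⟩
        have hwN := NN_nonneg (BB_NN y2)
        rw [sig_fst, sig_snd] at hwN
        have hwA : sig w ∈ chA n := by
          rw [mem_chA, sig_fst, sig_snd]
          simp only [hP, Set.mem_ofPred_eq] at x4
          omega
        have y3 : ¬ ad n S (sig w) := fun h => w2 ⟨by omega, Or.inr ⟨h, hwA⟩⟩
        have hwS : w ∉ S := fun h => x3 ⟨by omega, y2, y3, hwA, h⟩
        refine ⟨⟨?_, ?_, ?_⟩, hwS⟩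
        · have := sig_chC (chA_sub hn0 hwA)
          rwa [sig_sig] at this
        · unfold lr; rw [if_neg hw]; exact y2
        · unfold lr; rw [if_neg hw]; exact y3
    have hcU := (mid c k1.right).1
    have hbU := (mid b k1.left).1
    have hseg : Cn (Phi n S ∩ chC n) (sig b) (sig c) := by
      refine k1.map sig sig_HA (fun w hw => ?_)
      obtain ⟨m1, m2⟩ := mid w hw
      exact ⟨Or.inl ⟨UU_sig m1, by rw [sig_sig]; exact m2⟩, sig_chC m1.1⟩
    have hsB : sig b ∈ BB n S ∧ ¬ ad n S (sig b) := by
      have z1 := hbU.2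
      rw [← lr_sig] at z1
      unfold lr at z1
      rw [if_pos (by rw [sig_fst]; have := h2.1; omega)] at z1
      exact z1
    have hsab := sig_HA _ _ h3
    have hGP := GG_Phi hG
    have ha1 : 1 ≤ a.1 := h2.1
    have hb : ∃ u : Site, u.1 = -n ∧ Cn (Phi n S ∩ chA n) u (sig a) := by
      by_cases haB : sig a ∈ BB n S
      · rcases h2.2 with hc | hc
        · exact absurd haB hc
        · refine lemT hn0 hGP hc.2 (by rw [BB_Phi]; exact haB) (by rw [ad_Phi]; exact hc.1)
      · exfalso
        refine hsB.2 ⟨sig a, nb_WW hsB.1 haB ?_ hsab.symm, hsab.symm⟩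
        rw [sig_fst]; omega
    obtain ⟨u, hu, hua⟩ := hb
    refine hno' ⟨u, sig c, hu, ?_, ((hua.mono (Set.inter_subset_inter_right _
      (chA_sub hn0))).tail hsab hseg.left).trans hseg⟩
    have hcC := mem_chC.1 hcU.1
    have hcQ : c ∉ Q := k1.right.2
    simp only [hQ, Set.mem_ofPred_eq] at hcQ k4
    simp only [TR, Set.mem_ofPred_eq, sig_fst, sig_snd]
    unfold HA at k2
    omega
  -- the loop
  obtain ⟨g, hg⟩ := hex_parity (n + 1) K A W (fun v h => h.right) (fun v h => h.right)
    (fun a ha c hc h => Cn.tail ha h hc) (fun a ha c hc h => Cn.tail ha h hc)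
  have bK : ∀ v : Site, v.1 ≤ 0 → v.2 ≤ -1 → v ∈ K := fun v h1 h2 => Or.inl ⟨h1, bZ v h1 h2⟩
  have s0 : ((0, -1) : Site) ∈ A := Cn.refl (bK _ (by simp) (by simp))
  have w0 : ((1, -2) : Site) ∈ W := Cn.refl (wV _ (by simp) (by simp))
  have e0 := hg (0, -1) (1, -2) (by simp [HA]) (by simp; omega) (by simp; omega)
  have nA : ∀ v, v ∉ K → v ∉ A := fun v h h' => h (Cn.right h')
  have p1 : Cn {w : Site | w.1 ≤ n + 1 ∧ w ∉ A} (1, -2) (-n - 1, 0) := by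
    have q1 : Cn {w : Site | w.1 ≤ n + 1 ∧ w ∉ A} (1, -n - 2) (1, -2) :=
      Cn.vert _ (by omega) (by
        intro y h1 h2
        exact ⟨by simp; omega, nA _ (wV _ (by simp) (by simp; omega))⟩)
    have q2 : Cn {w : Site | w.1 ≤ n + 1 ∧ w ∉ A} (1, -n - 2) (n + 1, -n - 2) :=
      Cn.horiz _ (by omega) (by
        intro x h1 h2
        exact ⟨by simp; omega, nA _ (wV _ h1 (by simp; omega))⟩)
    have q3 : Cn {w : Site | w.1 ≤ n + 1 ∧ w ∉ A} (n + 1, -n - 2) (n + 1, n + 1) :=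
      Cn.vert _ (by omega) (by
        intro y h1 h2
        refine ⟨by simp, ?_⟩
        by_cases h : y + (n + 1) < 0
        · exact nA _ (wV _ (by simp; omega) h)
        · exact nP _ (Or.inr ⟨by simp, by simp; omega⟩))
    have q4 : Cn {w : Site | w.1 ≤ n + 1 ∧ w ∉ A} (-n - 1, n + 1) (n + 1, n + 1) :=
      Cn.horiz _ (by omega) (by
        intro x h1 h2
        refine ⟨by simp; omega, ?_⟩
        by_cases h : x < 0
        · exact nA _ (wQ _ (Or.inr ⟨h, by simp⟩))
        · exact nP _ (Or.inl ⟨by simp; omega, by simp; omega⟩))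
    have q5 : Cn {w : Site | w.1 ≤ n + 1 ∧ w ∉ A} (-n - 1, 0) (-n - 1, n + 1) :=
      Cn.vert _ (by omega) (by
        intro y h1 h2
        exact ⟨by simp; omega, nA _ (wQ _ (Or.inl ⟨by simp, h1⟩))⟩)
    exact (((q1.symm.trans q2).trans q3).trans q4.symm).trans q5.symm
  have c1 := g_const hg p1 (fun w h => h.1) (Or.inl (fun w h => h.2))
  have nW : ∀ v, v ∈ K → v ∉ W := fun v h h' => (Cn.right h') h
  have p2 : Cn {w : Site | w.1 ≤ n + 1 ∧ w ∉ W} (-n - 1, 0) (0, -1) := by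
    have q1 : Cn {w : Site | w.1 ≤ n + 1 ∧ w ∉ W} (-n - 1, -1) (0, -1) :=
      Cn.horiz _ (by omega) (by
        intro x h1 h2
        exact ⟨by simp; omega, nW _ (bK _ h2 (by simp))⟩)
    have q2 : Cn {w : Site | w.1 ≤ n + 1 ∧ w ∉ W} (-n - 1, 0) (-n - 1, -1) :=
      Cn.step ⟨by simp; omega, nQ _ (Or.inl ⟨by simp, by simp⟩)⟩ (by simp [HA]) q1.left
    exact q2.trans q1
  have c2 := g_const hg p2 (fun w h => h.1) (Or.inr (fun w h => h.2))
  exact (e0.1 (c1.trans c2).symm) (Or.inl ⟨s0, w0⟩)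


/-! ### Crossing probabilities -/

/-- Horizontal crossing. -/
def HX (x0 x1 y0 y1 : ℤ) : Set Site → Prop :=
  Cx (Rect x0 x1 y0 y1) {v | v.1 = x0} {v | v.1 = x1}
/-- Vertical crossing. -/
def VX (x0 x1 y0 y1 : ℤ) : Set Site → Prop :=
  Cx (Rect x0 x1 y0 y1) {v | v.2 = y0} {v | v.2 = y1}

theorem HX_inc (x0 x1 y0 y1 : ℤ) : Inc (HX x0 x1 y0 y1) := Cx_inc (Rect_finite _ _ _ _) _ _
theorem VX_inc (x0 x1 y0 y1 : ℤ) : Inc (VX x0 x1 y0 y1) := Cx_inc (Rect_finite _ _ _ _) _ _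

/-- Translations. -/
def trl (a b : ℤ) : Site ≃ Site where
  toFun v := (v.1 + a, v.2 + b)
  invFun v := (v.1 - a, v.2 - b)
  left_inv v := by ext <;> simp
  right_inv v := by ext <;> simp

/-- Swap of the coordinates. -/
def swp (a b : ℤ) : Site ≃ Site where
  toFun v := (v.2 + a, v.1 + b)
  invFun v := (v.2 - b, v.1 - a)
  left_inv v := by ext <;> simp
  right_inv v := by ext <;> simp

/-- Point reflections. -/
def rho (a b : ℤ) : Site ≃ Site where
  toFun v := (a - v.1, b - v.2)
  invFun v := (a - v.1, b - v.2)
  left_inv v := by ext <;> simp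
  right_inv v := by ext <;> simp

theorem trl_HA (a b : ℤ) (u v : Site) (h : HA u v) : HA (trl a b u) (trl a b v) := by
  unfold HA at *; simp only [trl, Equiv.coe_fn_mk]; omega
theorem swp_HA (a b : ℤ) (u v : Site) (h : HA u v) : HA (swp a b u) (swp a b v) := by
  unfold HA at *; simp only [swp, Equiv.coe_fn_mk]; omega
theorem rho_HA (a b : ℤ) (u v : Site) (h : HA u v) : HA (rho a b u) (rho a b v) := by
  unfold HA at *; simp only [rho, Equiv.coe_fn_mk]; omega


theorem HX_trl {μ : Measure (Site → ℝ)} (hμ : IsUniformCoupling μ)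
    (x0 x1 y0 y1 x0' x1' y0' y1' : ℤ) (h1 : x1' - x0' = x1 - x0)
    (h2 : y1' - y0' = y1 - y0) : Pr μ (HX x0 x1 y0 y1) ≤ Pr μ (HX x0' x1' y0' y1') := by
  refine Cx_map hμ (Rect_finite _ _ _ _) (trl (x0' - x0) (y0' - y0)) (trl_HA _ _) ?_ ?_ ?_
  all_goals
    intro v hv
    simp only [mem_Rect, trl, Equiv.coe_fn_mk, Set.mem_ofPred_eq] at *
    omega

theorem VX_HX {μ : Measure (Site → ℝ)} (hμ : IsUniformCoupling μ)
    (x0 x1 y0 y1 x0' x1' y0' y1' : ℤ) (h1 : x1' - x0' = y1 - y0)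
    (h2 : y1' - y0' = x1 - x0) : Pr μ (VX x0 x1 y0 y1) ≤ Pr μ (HX x0' x1' y0' y1') := by
  refine Cx_map hμ (Rect_finite _ _ _ _) (swp (x0' - y0) (y0' - x0)) (swp_HA _ _) ?_ ?_ ?_
  all_goals
    intro v hv
    simp only [mem_Rect, swp, Equiv.coe_fn_mk, Set.mem_ofPred_eq] at *
    omega

theorem HX_VX {μ : Measure (Site → ℝ)} (hμ : IsUniformCoupling μ)
    (x0 x1 y0 y1 x0' x1' y0' y1' : ℤ) (h1 : x1' - x0' = y1 - y0)
    (h2 : y1' - y0' = x1 - x0) : Pr μ (HX x0 x1 y0 y1) ≤ Pr μ (VX x0' x1' y0' y1') := by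
  refine Cx_map hμ (Rect_finite _ _ _ _) (swp (x0' - y0) (y0' - x0)) (swp_HA _ _) ?_ ?_ ?_
  all_goals
    intro v hv
    simp only [mem_Rect, swp, Equiv.coe_fn_mk, Set.mem_ofPred_eq] at *
    omega

theorem HX_sq {μ : Measure (Site → ℝ)} (hμ : IsUniformCoupling μ)
    {x0 x1 y0 y1 : ℤ} (h : x0 ≤ x1) (h1 : y1 - y0 = x1 - x0) :
    1 / 2 ≤ Pr μ (HX x0 x1 y0 y1) := by
  have e1 : (1 : ℝ) ≤ Pr μ (fun S => HX x0 x1 y0 y1 S ∨ VX x0 x1 y0 y1 Sᶜ) := by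
    have := hμ.1
    have e : {ω : Site → ℝ | HX x0 x1 y0 y1 {v | ω v ≤ 1 / 2} ∨ VX x0 x1 y0 y1 {v | ω v ≤ 1 / 2}ᶜ}
      = Set.univ := Set.eq_univ_of_forall (fun ω => hex _ h (by omega))
    unfold Pr
    rw [e]
    simp
  have e2 := Pr_or hμ (HX x0 x1 y0 y1) (fun S => VX x0 x1 y0 y1 Sᶜ)
  have e3 : Pr μ (fun S => VX x0 x1 y0 y1 Sᶜ) = Pr μ (VX x0 x1 y0 y1) :=
    Pr_flip hμ (Cx_dep (Rect_finite _ _ _ _) _ _)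
  have e4 := VX_HX hμ x0 x1 y0 y1 x0 x1 y0 y1 (by omega) (by omega)
  linarith

theorem VX_sq {μ : Measure (Site → ℝ)} (hμ : IsUniformCoupling μ)
    {x0 x1 y0 y1 : ℤ} (h : x0 ≤ x1) (h1 : y1 - y0 = x1 - x0) :
    1 / 2 ≤ Pr μ (VX x0 x1 y0 y1) :=
  (HX_sq hμ h h1).trans (HX_VX hμ _ _ _ _ _ _ _ _ h1.symm h1)

theorem E1_prob {μ : Measure (Site → ℝ)} (hμ : IsUniformCoupling μ)
    {n : ℤ} (hn : 1 ≤ n) : 1 / 4 ≤ Pr μ (E1 n) := by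
  have hG : 1 / 2 ≤ Pr μ (GG n) := by
    refine (HX_sq hμ (x0 := -n) (x1 := 0) (y0 := 0) (y1 := n) (by omega) (by omega)).trans ?_
    refine Pr_mono hμ ?_
    rintro S ⟨p, p', hp, hp', hP⟩ v ⟨u, hu, hQ⟩ hv
    simp only [Set.mem_ofPred_eq] at hp hp'
    obtain ⟨w, h1, h2⟩ := cross_HV hP hQ
      (fun w hw => by have := mem_chA.1 hw.2; omega)
      (fun w hw => by have := mem_chA.1 hw.2; omega)
      (fun w hw _ => by have := mem_Rect.1 hw.2; omega)
      (fun w hw _ => by have := mem_Rect.1 hw.2; omega)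
    exact h2.right.1 h1.right.1
  have dG : DepOn (chC_finite n).toFinset (GG n) := by
    intro S
    have : W0 n (S ∩ ↑(chC_finite n).toFinset) = W0 n S := by
      unfold W0
      have : (S ∩ ↑(chC_finite n).toFinset)ᶜ ∩ chA n = Sᶜ ∩ chA n := by
        ext v
        have := @chA_sub n (by omega) v
        simp only [Set.Finite.coe_toFinset, Set.mem_inter_iff, Set.mem_compl_iff]
        tauto
      rw [this]
    unfold GG
    rw [this]
  have := Pr_invol hμ dG (Cx_dep (chC_finite n) _ _ : DepOn _ (E1 n)) (Phi n) (by
      intro S hS hSC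
      refine ⟨GG_Phi hS, ?_, Phi_Phi n S⟩
      rintro v (hv | hv)
      · simpa using hv.1.1
      · exact hSC hv.2) (fun S hS _ => chev_main hn hS)
  unfold E1
  linarith

/-- Crossing of the chevron. -/
theorem BC_prob {μ : Measure (Site → ℝ)} (hμ : IsUniformCoupling μ)
    {n : ℤ} (hn : 1 ≤ n) :
    1 / 16 ≤ Pr μ (Cx (chC n) {v | v.1 = -n} {v | v.1 = n}) := by
  have h1 := E1_prob hμ hn
  have h2 : Pr μ (E1 n) ≤
      Pr μ (Cx (chC n) {v | v.1 = n} {v | v.1 = -n ∨ (v.1 ≤ 0 ∧ v.2 = n)}) := by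
    refine Cx_map hμ (chC_finite n) sig sig_HA (fun v hv => sig_chC hv) ?_ ?_
    · intro v hv _
      simp only [sig_fst, Set.mem_ofPred_eq] at *
      omega
    · intro v hv _
      simp only [TR, sig_fst, sig_snd, Set.mem_ofPred_eq] at *
      omega
  have h3 := Pr_fkg hμ (Cx_inc (chC_finite n) {v | v.1 = -n} (TR n))
    (Cx_inc (chC_finite n) {v | v.1 = n} {v | v.1 = -n ∨ (v.1 ≤ 0 ∧ v.2 = n)})
  have h4 : (1 / 4 : ℝ) * (1 / 4) ≤ Pr μ (E1 n) *
    Pr μ (Cx (chC n) {v | v.1 = n} {v | v.1 = -n ∨ (v.1 ≤ 0 ∧ v.2 = n)}) :=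
    mul_le_mul h1 (h1.trans h2) (by norm_num) (Pr_nonneg _)
  refine le_trans (by linarith) (h4.trans (h3.trans (Pr_mono hμ ?_)))
  rintro S ⟨⟨p, p', hp, hp', hP⟩, q, q', hq, hq', hQ⟩
  simp only [TR, Set.mem_ofPred_eq] at hp hp' hq hq'
  rcases hp' with hp' | hp'
  · exact ⟨p, p', hp, hp', hP⟩
  rcases hq' with hq' | hq'
  · exact ⟨q', q, hq', hq, hQ.symm⟩
  obtain ⟨w, h1, h2⟩ := cross_top hP hQ
    (fun w hw => by have := mem_chC.1 hw.2; omega)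
    (fun w hw => by have := mem_chC.1 hw.2; omega)
    (fun w hw _ => by have := mem_chC.1 hw.2; omega)
    (fun w hw _ => by have := mem_chC.1 hw.2; omega) (by omega)
  exact ⟨p, q, hp, hq, h1.trans h2.symm⟩

theorem fkg3 {μ : Measure (Site → ℝ)} (hμ : IsUniformCoupling μ)
    {E1 E2 E3 : Set Site → Prop} (h1 : Inc E1) (h2 : Inc E2) (h3 : Inc E3)
    {a b c : ℝ} (hb : 0 ≤ b) (hc : 0 ≤ c) (e1 : a ≤ Pr μ E1)
    (e2 : b ≤ Pr μ E2) (e3 : c ≤ Pr μ E3) :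
    a * b * c ≤ Pr μ (fun S => (E1 S ∧ E2 S) ∧ E3 S) := by
  refine le_trans ?_ (Pr_fkg hμ (h1.and h2) h3)
  refine mul_le_mul (le_trans ?_ (Pr_fkg hμ h1 h2)) e3 hc (Pr_nonneg _)
  exact mul_le_mul e1 e2 hb (Pr_nonneg _)

theorem RSW3 {μ : Measure (Site → ℝ)} (hμ : IsUniformCoupling μ)
    {n : ℤ} (hn : 1 ≤ n) : 1 / 512 ≤ Pr μ (HX (-n) (2 * n) (-n) n) := by
  set R2 : Set Site := {v | rho n 0 v ∈ chC n} with hR2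
  have mR2 : ∀ v, v ∈ R2 ↔ 0 ≤ v.1 ∧ v.1 ≤ 2 * n ∧
    ((n ≤ v.1 ∧ -n ≤ v.2 ∧ v.2 ≤ 0) ∨ (v.1 < n ∧ 0 ≤ v.2 + v.1 ∧ v.2 + v.1 ≤ n)) := by
    intro v
    have : v ∈ R2 ↔ rho n 0 v ∈ chC n := Iff.rfl
    rw [this, mem_chC]
    simp only [rho, Equiv.coe_fn_mk]
    omega
  have fR2 : R2.Finite := (Rect_finite (-n) (2 * n) (-n) n).subset (by
    intro v hv; rw [mR2] at hv; rw [mem_Rect]; omega)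
  set R3 : Set Site := {v | 0 ≤ v.1 ∧ v.1 ≤ n ∧ 0 ≤ v.2 + v.1 ∧ v.2 + v.1 ≤ n} with hR3
  have fR3 : R3.Finite := (Rect_finite (-n) (2 * n) (-n) n).subset (by
    intro v hv; simp only [hR3, Set.mem_ofPred_eq] at hv; rw [mem_Rect]; omega)
  have p1 := BC_prob hμ hn
  have p2 : Pr μ (Cx (chC n) {v | v.1 = -n} {v | v.1 = n}) ≤
      Pr μ (Cx R2 {v | v.1 = 2 * n} {v | v.1 = 0}) := by
    refine Cx_map hμ (chC_finite n) (rho n 0) (rho_HA _ _) ?_ ?_ ?_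
    · intro v hv
      rw [mR2]
      rw [mem_chC] at hv
      simp only [rho, Equiv.coe_fn_mk]
      omega
    all_goals
      intro v hv _
      simp only [rho, Equiv.coe_fn_mk, Set.mem_ofPred_eq] at *
      omega
  have p3 : Pr μ (VX (-n) 0 0 n) ≤ Pr μ (Cx R3 {v | v.2 + v.1 = 0} {v | v.2 + v.1 = n}) := by
    refine Cx_map hμ (Rect_finite _ _ _ _) sig sig_HA ?_ ?_ ?_
    all_goals
      intro v hv
      simp only [hR3, mem_Rect, sig_fst, sig_snd, Set.mem_ofPred_eq] at *
      omega
  have p4 := VX_sq hμ (x0 := -n) (x1 := 0) (y0 := 0) (y1 := n) (by omega) (by omega)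
  have := fkg3 hμ (Cx_inc (chC_finite n) {v | v.1 = -n} {v | v.1 = n})
    (Cx_inc fR2 {v | v.1 = 2 * n} {v | v.1 = 0})
    (Cx_inc fR3 {v | v.2 + v.1 = 0} {v | v.2 + v.1 = n}) (by norm_num) (by norm_num)
    p1 (p1.trans p2) (p4.trans p3)
  refine le_trans (by norm_num) (this.trans (Pr_mono hμ ?_))
  rintro S ⟨⟨⟨p, p', hp, hp', hP⟩, q, q', hq, hq', hQ⟩, t, t', ht, ht', hT⟩
  simp only [Set.mem_ofPred_eq] at hp hp' hq hq' ht ht'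
  have mR3 : ∀ v, v ∈ R3 ↔ 0 ≤ v.1 ∧ v.1 ≤ n ∧ 0 ≤ v.2 + v.1 ∧ v.2 + v.1 ≤ n := fun v => Iff.rfl
  have ht1 := (mR3 _).1 hT.left.2
  have ht1' := (mR3 _).1 hT.right.2
  obtain ⟨w, a1, a2⟩ := cross_HV hP hT
    (fun w hw => by have := (mR3 _).1 hw.2; omega)
    (fun w hw => by have := (mR3 _).1 hw.2; omega)
    (fun w hw _ => by have := mem_chC.1 hw.2; omega)
    (fun w hw _ => by have := mem_chC.1 hw.2; omega)
  obtain ⟨z, b1, b2⟩ := cross_HV hQ.symm hT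
    (fun w hw => by have := (mR3 _).1 hw.2; omega)
    (fun w hw => by have := (mR3 _).1 hw.2; omega)
    (fun w hw _ => by have := (mR2 _).1 hw.2; omega)
    (fun w hw _ => by have := (mR2 _).1 hw.2; omega)
  have s1 : S ∩ chC n ⊆ S ∩ Rect (-n) (2 * n) (-n) n := by
    rintro v ⟨h1, h2⟩
    refine ⟨h1, ?_⟩
    rw [mem_chC] at h2; rw [mem_Rect]; omega
  have s2 : S ∩ R2 ⊆ S ∩ Rect (-n) (2 * n) (-n) n := by
    rintro v ⟨h1, h2⟩
    refine ⟨h1, ?_⟩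
    rw [mR2] at h2; rw [mem_Rect]; omega
  have s3 : S ∩ R3 ⊆ S ∩ Rect (-n) (2 * n) (-n) n := by
    rintro v ⟨h1, h2⟩
    refine ⟨h1, ?_⟩
    rw [mR3] at h2; rw [mem_Rect]; omega
  exact ⟨p, q, hp, hq, (a1.mono s1).trans ((a2.mono s3).symm.trans
    ((b2.mono s3).trans ((b1.mono s2).symm.trans (hQ.symm.mono s2))))⟩

theorem HX_glue {μ : Measure (Site → ℝ)} (hμ : IsUniformCoupling μ)
    {x0 x1 x2 x3 y0 y1 : ℤ} {a b c : ℝ} (h01 : x0 ≤ x1) (h23 : x2 ≤ x3)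
    (hb : 0 ≤ b) (hc : 0 ≤ c) (e1 : a ≤ Pr μ (HX x0 x2 y0 y1)) (e2 : b ≤ Pr μ (HX x1 x3 y0 y1))
    (e3 : c ≤ Pr μ (VX x1 x2 y0 y1)) : a * b * c ≤ Pr μ (HX x0 x3 y0 y1) := by
  refine (fkg3 hμ (HX_inc _ _ _ _) (HX_inc _ _ _ _) (VX_inc _ _ _ _) hb hc e1 e2 e3).trans
    (Pr_mono hμ ?_)
  rintro S ⟨⟨⟨p, p', hp, hp', hP⟩, q, q', hq, hq', hQ⟩, t, t', ht, ht', hT⟩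
  simp only [Set.mem_ofPred_eq] at hp hp' hq hq' ht ht'
  obtain ⟨w, a1, a2⟩ := cross_HV hP hT
    (fun w hw => by have := mem_Rect.1 hw.2; omega)
    (fun w hw => by have := mem_Rect.1 hw.2; omega)
    (fun w hw _ => by have := mem_Rect.1 hw.2; omega)
    (fun w hw _ => by have := mem_Rect.1 hw.2; omega)
  obtain ⟨z, b1, b2⟩ := cross_HV hQ hT
    (fun w hw => by have := mem_Rect.1 hw.2; omega)
    (fun w hw => by have := mem_Rect.1 hw.2; omega)
    (fun w hw _ => by have := mem_Rect.1 hw.2; omega)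
    (fun w hw _ => by have := mem_Rect.1 hw.2; omega)
  have s : ∀ a b, x0 ≤ a → b ≤ x3 → S ∩ Rect a b y0 y1 ⊆ S ∩ Rect x0 x3 y0 y1 := by
    rintro a b ha hb v ⟨h1, h2⟩
    refine ⟨h1, ?_⟩
    rw [mem_Rect] at *; omega
  have s1 := s x0 x2 (by omega) (by omega)
  have s2 := s x1 x3 (by omega) (by omega)
  have s3 := s x1 x2 (by omega) (by omega)
  exact ⟨p, q', hp, hq', (a1.mono s1).trans ((a2.mono s3).symm.trans
    ((b2.mono s3).trans ((b1.mono s2).symm.trans (hQ.mono s2))))⟩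

theorem RSW6 {μ : Measure (Site → ℝ)} (hμ : IsUniformCoupling μ)
    : ∃ δ : ℝ, 0 < δ ∧ ∀ n : ℤ, 1 ≤ n → ∀ x0 x1 y0 y1 : ℤ, x1 - x0 = 6 * n →
    y1 - y0 = 2 * n → δ ≤ Pr μ (HX x0 x1 y0 y1) := by
  refine ⟨1 / 512 * (1 / 512) * (1 / 2) * (1 / 512) * (1 / 2) * (1 / 512) * (1 / 2), by norm_num, ?_⟩
  intro n hn x0 x1 y0 y1 hx hy
  have b : ∀ x : ℤ, 1 / 512 ≤ Pr μ (HX x (x + 3 * n) y0 y1) := fun x =>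
    (RSW3 hμ hn).trans (HX_trl hμ _ _ _ _ _ _ _ _ (by omega) (by omega))
  have sq : ∀ x : ℤ, 1 / 2 ≤ Pr μ (VX x (x + 2 * n) y0 y1) := fun x =>
    VX_sq hμ (by omega) (by omega)
  have h4 := HX_glue hμ (x0 := x0) (x1 := x0 + n) (x2 := x0 + 3 * n) (x3 := x0 + 4 * n) (y0 := y0)
    (y1 := y1) (by omega) (by omega) (b := 1 / 512) (c := 1 / 2) (by norm_num) (by norm_num) (b x0)
    (by have := b (x0 + n); rwa [show x0 + n + 3 * n = x0 + 4 * n by ring] at this)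
    (by have := sq (x0 + n); rwa [show x0 + n + 2 * n = x0 + 3 * n by ring] at this)
  have h5 := HX_glue hμ (x0 := x0) (x1 := x0 + 2 * n) (x2 := x0 + 4 * n) (x3 := x0 + 5 * n) (y0 := y0)
    (y1 := y1) (by omega) (by omega) (b := 1 / 512) (c := 1 / 2) (by norm_num) (by norm_num) h4
    (by have := b (x0 + 2 * n); rwa [show x0 + 2 * n + 3 * n = x0 + 5 * n by ring] at this)
    (by have := sq (x0 + 2 * n); rwa [show x0 + 2 * n + 2 * n = x0 + 4 * n by ring] at this)
  have h6 := HX_glue hμ (x0 := x0) (x1 := x0 + 3 * n) (x2 := x0 + 5 * n) (x3 := x0 + 6 * n) (y0 := y0)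
    (y1 := y1) (by omega) (by omega) (b := 1 / 512) (c := 1 / 2) (by norm_num) (by norm_num) h5
    (by have := b (x0 + 3 * n); rwa [show x0 + 3 * n + 3 * n = x0 + 6 * n by ring] at this)
    (by have := sq (x0 + 3 * n); rwa [show x0 + 3 * n + 2 * n = x0 + 5 * n by ring] at this)
  rwa [show x0 + 6 * n = x1 by omega] at h6



/-! ### Circuits -/

/-- Four long crossings around the annulus. -/
def Circ (r : ℤ) (S : Set Site) : Prop :=
  (HX (-3 * r) (3 * r) r (3 * r) S ∧ HX (-3 * r) (3 * r) (-3 * r) (-r) S) ∧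
  (VX r (3 * r) (-3 * r) (3 * r) S ∧ VX (-3 * r) (-r) (-3 * r) (3 * r) S)

theorem Circ_inc (r : ℤ) : Inc (Circ r) :=
  ((HX_inc _ _ _ _).and (HX_inc _ _ _ _)).and ((VX_inc _ _ _ _).and (VX_inc _ _ _ _))

theorem Circ_dep {r : ℤ} (hr : 0 ≤ r) : ∃ Λ : Finset Site, DepOn Λ (Circ r) ∧
    ∀ v ∈ Λ, ¬ (-r < v.1 ∧ v.1 < r ∧ -r < v.2 ∧ v.2 < r) := by
  classical
  have f : ({v : Site | v ∈ Rect (-3 * r) (3 * r) (-3 * r) (3 * r) ∧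
    ¬ (-r < v.1 ∧ v.1 < r ∧ -r < v.2 ∧ v.2 < r)}).Finite :=
    (Rect_finite _ _ _ _).subset (fun v hv => hv.1)
  refine ⟨f.toFinset, ?_, fun v hv => ((Set.Finite.mem_toFinset f).1 hv).2⟩
  have d1 : ∀ x0 x1 y0 y1, Rect x0 x1 y0 y1 ⊆ {v : Site | v ∈ Rect (-3 * r) (3 * r) (-3 * r) (3 * r) ∧
    ¬ (-r < v.1 ∧ v.1 < r ∧ -r < v.2 ∧ v.2 < r)} →
    (Rect_finite x0 x1 y0 y1).toFinset ⊆ f.toFinset := by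
    intro x0 x1 y0 y1 h
    exact Set.Finite.toFinset_subset_toFinset.2 h
  intro S
  refine and_congr (and_congr ?_ ?_) (and_congr ?_ ?_)
  all_goals
    refine (Cx_dep (Rect_finite _ _ _ _) _ _).mono (d1 _ _ _ _ ?_) S
    intro v hv
    rw [mem_Rect] at hv
    refine ⟨mem_Rect.2 ?_, ?_⟩ <;> omega

theorem Circ_prob {μ : Measure (Site → ℝ)} (hμ : IsUniformCoupling μ) :
    ∃ δ : ℝ, 0 < δ ∧ ∀ r : ℤ, 1 ≤ r → δ ≤ Pr μ (Circ r) := by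
  obtain ⟨δ, hδ, h⟩ := RSW6 hμ
  refine ⟨δ * δ * (δ * δ), by positivity, fun r hr => ?_⟩
  have hv : ∀ x0 x1 y0 y1 : ℤ, x1 - x0 = 2 * r → y1 - y0 = 6 * r → δ ≤ Pr μ (VX x0 x1 y0 y1) :=
    fun x0 x1 y0 y1 hx hy => (h r hr 0 (6 * r) 0 (2 * r) (by omega) (by omega)).trans
      (HX_VX hμ _ _ _ _ _ _ _ _ (by omega) (by omega))
  refine le_trans ?_ (Pr_fkg hμ ((HX_inc _ _ _ _).and (HX_inc _ _ _ _))
    ((VX_inc _ _ _ _).and (VX_inc _ _ _ _)))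
  refine mul_le_mul (le_trans ?_ (Pr_fkg hμ (HX_inc _ _ _ _) (HX_inc _ _ _ _)))
    (le_trans ?_ (Pr_fkg hμ (VX_inc _ _ _ _) (VX_inc _ _ _ _))) (by positivity) (Pr_nonneg _)
  · exact mul_le_mul (h r hr _ _ _ _ (by omega) (by omega)) (h r hr _ _ _ _ (by omega) (by omega))
      hδ.le (Pr_nonneg _)
  · exact mul_le_mul (hv _ _ _ _ (by omega) (by omega)) (hv _ _ _ _ (by omega) (by omega))
      hδ.le (Pr_nonneg _)

theorem Cn.self {X : Set Site} {u v : Site} (h : Cn X u v) : Cn {w | Cn X u w} u v :=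
  h.ind (fun a => Cn {w | Cn X u w} u a) (Cn.refl (Cn.refl h.left))
    (fun _ _ hc ih hab hb => ih.tail hab (hc.tail hab hb))

theorem Circ_block {r : ℤ} (hr : 1 ≤ r) {S : Set Site} (hC : Circ r S) :
    ∃ z, ∀ T u v, Cn T u v → u ∈ Rect (-r) r (-r) r →
      ¬ (-3 * r < v.1 ∧ v.1 < 3 * r ∧ -3 * r < v.2 ∧ v.2 < 3 * r) →
      ∃ w, Cn T u w ∧ Cn (S ∩ Rect (-3 * r) (3 * r) (-3 * r) (3 * r)) z w := by
  obtain ⟨⟨⟨a, a', ha, ha', hA⟩, b, b', hb, hb', hB⟩, ⟨c, c', hc, hc', hC⟩, d, d', hd, hd', hD⟩ := hC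
  simp only [Set.mem_ofPred_eq] at ha ha' hb hb' hc hc' hd hd'
  set Q := S ∩ Rect (-3 * r) (3 * r) (-3 * r) (3 * r) with hQ
  have sub : ∀ x0 x1 y0 y1 : ℤ, -3 * r ≤ x0 → x1 ≤ 3 * r → -3 * r ≤ y0 → y1 ≤ 3 * r →
      S ∩ Rect x0 x1 y0 y1 ⊆ Q := by
    rintro x0 x1 y0 y1 h1 h2 h3 h4 v ⟨h5, h6⟩
    refine ⟨h5, ?_⟩
    rw [mem_Rect] at *; omega
  have sA := sub (-3 * r) (3 * r) r (3 * r) (by omega) (by omega) (by omega) (by omega)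
  have sB := sub (-3 * r) (3 * r) (-3 * r) (-r) (by omega) (by omega) (by omega) (by omega)
  have sC := sub r (3 * r) (-3 * r) (3 * r) (by omega) (by omega) (by omega) (by omega)
  have sD := sub (-3 * r) (-r) (-3 * r) (3 * r) (by omega) (by omega) (by omega) (by omega)
  have ac : Cn Q a c := by
    obtain ⟨w, h1, h2⟩ := cross_HV hA hC
      (fun w hw => by have := mem_Rect.1 hw.2; omega)
      (fun w hw => by have := mem_Rect.1 hw.2; omega)
      (fun w hw _ => by have := mem_Rect.1 hw.2; omega)
      (fun w hw _ => by have := mem_Rect.1 hw.2; omega)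
    exact (h1.mono sA).trans (h2.mono sC).symm
  have ad : Cn Q a d := by
    obtain ⟨w, h1, h2⟩ := cross_HV hA hD
      (fun w hw => by have := mem_Rect.1 hw.2; omega)
      (fun w hw => by have := mem_Rect.1 hw.2; omega)
      (fun w hw _ => by have := mem_Rect.1 hw.2; omega)
      (fun w hw _ => by have := mem_Rect.1 hw.2; omega)
    exact (h1.mono sA).trans (h2.mono sD).symm
  have bc : Cn Q b c := by
    obtain ⟨w, h1, h2⟩ := cross_HV hB hC
      (fun w hw => by have := mem_Rect.1 hw.2; omega)
      (fun w hw => by have := mem_Rect.1 hw.2; omega)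
      (fun w hw _ => by have := mem_Rect.1 hw.2; omega)
      (fun w hw _ => by have := mem_Rect.1 hw.2; omega)
    exact (h1.mono sB).trans (h2.mono sC).symm
  have ab : Cn Q a b := ac.trans bc.symm
  refine ⟨a, fun T u v hT hu hv => ?_⟩
  rw [mem_Rect] at hu
  set Y : Set Site := {v | -3 * r < v.1 ∧ v.1 < 3 * r ∧ -3 * r < v.2 ∧ v.2 < 3 * r} with hY
  have huY : u ∈ Y := by
    simp only [hY, Set.mem_ofPred_eq]; omega
  obtain ⟨e, f, h1, h2, h3, h4⟩ := hT.self.exit huY hv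
  have hf := h2.bounds
  have heY : -3 * r < e.1 ∧ e.1 < 3 * r ∧ -3 * r < e.2 ∧ e.2 < 3 * r := h1.right.2
  set Z : Set Site := {w | Cn T u w} ∩ Rect (-3 * r) (3 * r) (-3 * r) (3 * r) with hZ
  have hfZ : f ∈ Z := ⟨h3, by rw [mem_Rect]; omega⟩
  have hcon : Cn Z u f := by
    refine Cn.tail (h1.mono ?_) h2 hfZ
    rintro w ⟨h5, h6⟩
    refine ⟨h5, ?_⟩
    simp only [hY, Set.mem_ofPred_eq] at h6
    rw [mem_Rect]; omega
  have hf4 : f.1 = 3 * r ∨ f.1 = -3 * r ∨ f.2 = 3 * r ∨ f.2 = -3 * r := by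
    have hff : ¬ (-3 * r < f.1 ∧ f.1 < 3 * r ∧ -3 * r < f.2 ∧ f.2 < 3 * r) := h4
    clear_value Q Y Z
    omega
  rcases hf4 with h | h | h | h
  · obtain ⟨p, p', e1, e2, hP⟩ := hcon.strip (fun v => v.1) (fun a b h => h.bounds.1)
      (a := r) (b := 3 * r) (by omega) (by omega) (by omega)
    obtain ⟨w, h5, h6⟩ := cross_HV hP hC
      (fun w hw => by have := mem_Rect.1 hw.2; omega)
      (fun w hw => by have := mem_Rect.1 hw.2; omega)
      (fun w hw _ => by have := mem_Rect.1 hw.1.2; omega)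
      (fun w hw _ => by have := mem_Rect.1 hw.1.2; omega)
    exact ⟨w, h5.right.1.1, ac.trans (h6.mono sC)⟩
  · obtain ⟨p, p', e1, e2, hP⟩ := hcon.strip (fun v => -v.1) (fun a b h => by
        have := h.bounds; omega)
      (a := r) (b := 3 * r) (by omega) (by omega) (by omega)
    obtain ⟨w, h5, h6⟩ := cross_HV hP.symm hD
      (fun w hw => by have := mem_Rect.1 hw.2; omega)
      (fun w hw => by have := mem_Rect.1 hw.2; omega)
      (fun w hw _ => by have := mem_Rect.1 hw.1.2; omega)
      (fun w hw _ => by have := mem_Rect.1 hw.1.2; omega)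
    exact ⟨w, h5.right.1.1, ad.trans (h6.mono sD)⟩
  · obtain ⟨p, p', e1, e2, hP⟩ := hcon.strip (fun v => v.2) (fun a b h => h.bounds.2.2.1)
      (a := r) (b := 3 * r) (by omega) (by omega) (by omega)
    obtain ⟨w, h5, h6⟩ := cross_HV hA hP
      (fun w hw => by have := mem_Rect.1 hw.1.2; omega)
      (fun w hw => by have := mem_Rect.1 hw.1.2; omega)
      (fun w hw _ => by have := mem_Rect.1 hw.2; omega)
      (fun w hw _ => by have := mem_Rect.1 hw.2; omega)
    exact ⟨w, h6.right.1.1, h5.mono sA⟩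
  · obtain ⟨p, p', e1, e2, hP⟩ := hcon.strip (fun v => -v.2) (fun a b h => by
        have := h.bounds; omega)
      (a := r) (b := 3 * r) (by omega) (by omega) (by omega)
    obtain ⟨w, h5, h6⟩ := cross_HV hB hP.symm
      (fun w hw => by have := mem_Rect.1 hw.1.2; omega)
      (fun w hw => by have := mem_Rect.1 hw.1.2; omega)
      (fun w hw _ => by have := mem_Rect.1 hw.2; omega)
      (fun w hw _ => by have := mem_Rect.1 hw.2; omega)
    exact ⟨w, h6.right.1.1, ab.trans (h5.mono sB)⟩


/-! ### Link with the arm events -/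

theorem exp_pi3 : Complex.exp (Complex.I * (Real.pi / 3)) = ⟨1 / 2, √3 / 2⟩ := by
  have : Complex.I * ((Real.pi : ℂ) / 3) = ((Real.pi / 3 : ℝ) : ℂ) * Complex.I := by
    push_cast; ring
  rw [this, Complex.exp_mul_I, ← Complex.ofReal_cos, ← Complex.ofReal_sin, Real.cos_pi_div_three,
    Real.sin_pi_div_three]
  apply Complex.ext <;> simp

theorem embed_re (v : Site) : (embed v).re = v.1 + v.2 / 2 := by
  unfold embed; rw [exp_pi3]; simp; ring

theorem embed_im (v : Site) : (embed v).im = v.2 * (√3 / 2) := by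
  unfold embed; rw [exp_pi3]; simp

theorem Tri_iff (u v : Site) : Tri.Adj u v ↔ HA u v := by
  have h0 : Tri.Adj u v ↔ dist (embed u) (embed v) = 1 := Iff.rfl
  have h3 : √3 ^ 2 = 3 := Real.sq_sqrt (by norm_num)
  have h1 : dist (embed u) (embed v) ^ 2 =
      (((u.1 - v.1) ^ 2 + (u.1 - v.1) * (u.2 - v.2) + (u.2 - v.2) ^ 2 : ℤ) : ℝ) := by
    rw [Complex.dist_eq, ← Complex.normSq_eq_norm_sq, Complex.normSq_apply, Complex.sub_re,
      Complex.sub_im, embed_re, embed_re, embed_im, embed_im]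
    push_cast
    linear_combination ((u.2 : ℝ) - v.2) ^ 2 / 4 * h3
  have h2 : dist (embed u) (embed v) = 1 ↔
      (u.1 - v.1) ^ 2 + (u.1 - v.1) * (u.2 - v.2) + (u.2 - v.2) ^ 2 = 1 := by
    constructor
    · intro h
      rw [h] at h1
      have : ((((u.1 - v.1) ^ 2 + (u.1 - v.1) * (u.2 - v.2) + (u.2 - v.2) ^ 2 : ℤ)) : ℝ) = (1 : ℤ) := by
        rw [← h1]; norm_num
      exact_mod_cast this
    · intro h
      rw [h] at h1
      have h4 : (0 : ℝ) ≤ dist (embed u) (embed v) := dist_nonneg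
      have : dist (embed u) (embed v) ^ 2 = 1 := by rw [h1]; norm_num
      nlinarith
  rw [h0, h2]
  obtain ⟨a, b⟩ := u
  obtain ⟨c, d⟩ := v
  unfold HA
  simp only
  constructor
  · intro h
    generalize hx : a - c = x at h
    generalize hy : b - d = y at h
    have x1 : x ≤ 1 := by nlinarith [sq_nonneg (x + 2 * y)]
    have x2 : -1 ≤ x := by nlinarith [sq_nonneg (x + 2 * y)]
    have y1 : y ≤ 1 := by nlinarith [sq_nonneg (2 * x + y)]
    have y2 : -1 ≤ y := by nlinarith [sq_nonneg (2 * x + y)]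
    interval_cases x <;> interval_cases y <;> simp at h <;> omega
  · rintro (h | h | h | h | h | h) <;> rw [h.1, h.2] <;> ring

theorem mem_box {n : ℝ} {v : Site} : v ∈ box n ↔
    |(v.1 : ℝ) + v.2 / 2| ≤ n ∧ |(v.2 : ℝ) * (√3 / 2)| ≤ n := by
  unfold box
  rw [Set.mem_ofPred_eq, embed_re, embed_im]

theorem sqrt3_bd : (1.7 : ℝ) ≤ √3 ∧ √3 ≤ 1.8 := by
  constructor
  · exact Real.le_sqrt_of_sq_le (by norm_num)
  · exact Real.sqrt_le_iff.2 ⟨by norm_num, by norm_num⟩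

/-- Box inside a rhombus. -/
theorem box_bd {n : ℝ} {v : Site} (h : v ∈ box n) :
    |(v.1 : ℝ)| ≤ 1.6 * n ∧ |(v.2 : ℝ)| ≤ 1.6 * n := by
  rw [mem_box, abs_le, abs_le] at h
  obtain ⟨s1, s2⟩ := sqrt3_bd
  obtain ⟨⟨h1, h2⟩, h3, h4⟩ := h
  have hn : 0 ≤ n := by linarith
  have a1 : (v.2 : ℝ) ≤ 1.2 * n := by
    by_contra hc
    push Not at hc
    nlinarith
  have a2 : -(1.2 * n) ≤ (v.2 : ℝ) := by
    by_contra hc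
    push Not at hc
    nlinarith
  refine ⟨abs_le.2 ⟨by linarith, by linarith⟩, abs_le.2 ⟨by linarith, by linarith⟩⟩

/-- Rhombus inside a box. -/
theorem bd_box {n : ℝ} {v : Site} (h1 : |(v.1 : ℝ)| ≤ 2 / 3 * n) (h2 : |(v.2 : ℝ)| ≤ 2 / 3 * n) :
    v ∈ box n := by
  rw [mem_box, abs_le, abs_le]
  obtain ⟨s1, s2⟩ := sqrt3_bd
  rw [abs_le] at h1 h2
  have hn : 0 ≤ n := by linarith
  refine ⟨⟨by linarith, by linarith⟩, ?_, ?_⟩ <;> nlinarith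

theorem box_finite (n : ℝ) : (box n).Finite := by
  refine (Rect_finite (-⌈1.6 * n⌉) ⌈1.6 * n⌉ (-⌈1.6 * n⌉) ⌈1.6 * n⌉).subset ?_
  intro v hv
  obtain ⟨h1, h2⟩ := box_bd hv
  rw [abs_le] at h1 h2
  have hc := Int.le_ceil (1.6 * n)
  rw [mem_Rect]
  refine ⟨?_, ?_, ?_, ?_⟩ <;> (rw [← Int.cast_le (R := ℝ)]; push_cast; linarith)

theorem box_mono {m n : ℝ} (h : m ≤ n) : box m ⊆ box n := fun _ hv => ⟨hv.1.trans h, hv.2.trans h⟩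

/-- The starting sites. -/
def Near : Set Site := {u | u ∈ box 0 ∨ AdjSet u (box 0)}

theorem box_zero {v : Site} (h : v ∈ box 0) : v = 0 := by
  obtain ⟨h1, h2⟩ := box_bd h
  simp at h1 h2
  exact Prod.ext h1 h2

theorem zero_near : (0 : Site) ∈ Near := Or.inl (by rw [mem_box]; simp)

theorem near_bd {u : Site} (h : u ∈ Near) : -1 ≤ u.1 ∧ u.1 ≤ 1 ∧ -1 ≤ u.2 ∧ u.2 ≤ 1 := by
  rcases h with h | ⟨w, hw, h⟩
  · rw [box_zero h]; simp
  · rw [Tri_iff, box_zero hw] at h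
    have := h.bounds
    simp at this
    omega

theorem near_box {u : Site} (h : u ∈ Near) {n : ℝ} (hn : 1 ≤ n) : u ∈ box n := by
  rcases h with h | ⟨w, hw, h⟩
  · exact box_mono (by linarith) h
  · rw [Tri_iff, box_zero hw] at h
    have h' := h.symm
    obtain ⟨a, b⟩ := u
    obtain ⟨s1, s2⟩ := sqrt3_bd
    refine box_mono hn ?_
    rw [mem_box]
    unfold HA at h'
    simp only [Prod.fst_zero, Prod.snd_zero] at h'
    rcases h' with h | h | h | h | h | h <;> simp only [h.1, h.2] <;> push_cast <;>
      rw [abs_le, abs_le] <;> refine ⟨⟨?_, ?_⟩, ?_, ?_⟩ <;> linarith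

theorem mem_bdry {n : ℝ} {v : Site} : v ∈ innerBdry (box n) ↔ v ∈ box n ∧ ∃ u, u ∉ box n ∧ HA v u := by
  unfold innerBdry
  simp only [Set.mem_ofPred_eq, Tri_iff]

/-- The arm event. -/
def Arm (n : ℝ) : Set Site → Prop := Cx (box n) Near (innerBdry (box n))

theorem pi1n_eq (μ : Measure (Site → ℝ)) (n : ℝ) : pi1n μ n = Pr μ (Arm n) := by
  unfold pi1n pi1 prob Pr
  congr 2
  ext ω
  have key : ∀ u v, ConnIn pc ω (box n) u v ↔ Cn ({v | ω v ≤ 1 / 2} ∩ box n) u v := by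
    intro u v
    unfold ConnIn
    rw [SimpleGraph.reachable_iff_reflTransGen]
    have hb : ∀ w, Black pc ω w ↔ ω w ≤ 1 / 2 := fun w => Iff.rfl
    constructor
    · rintro ⟨h1, h2, h3, h4, h5⟩
      refine ⟨⟨h3, h1⟩, ?_⟩
      refine Relation.ReflTransGen.mono ?_ _ _ h5
      rintro a b ⟨⟨h6, h7, h8⟩, h9, h10⟩
      exact ⟨(Tri_iff _ _).1 h6, h8, h10⟩
    · intro h
      refine ⟨h.left.2, h.right.2, h.left.1, h.right.1, ?_⟩
      refine h.ind (fun a => Relation.ReflTransGen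
        (restrictGraph (blackGraph pc ω) (box n)).Adj u a) .refl ?_
      intro a b ha ih hab hb
      exact ih.tail ⟨⟨(Tri_iff _ _).2 hab, ha.right.1, hb.1⟩, ha.right.2, hb.2⟩
  constructor
  · rintro ⟨u, v, h1, h2, h3⟩
    exact ⟨u, v, h2, h3, (key u v).1 h1⟩
  · rintro ⟨u, v, h1, h2, h3⟩
    exact ⟨u, v, (key u v).2 h3, h1, h2⟩

/-- A path leaving the box contains an arm. -/
theorem arm_of {n : ℝ} {T : Set Site} {u v z : Site} (hu : u ∈ box n) (h : Cn T u v)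
    (hz : z = v ∨ HA v z) (hzn : z ∉ box n) :
    ∃ a ∈ innerBdry (box n), Cn (T ∩ box n) u a := by
  by_cases hv : v ∈ box n ∧ Cn (T ∩ box n) u v
  · refine ⟨v, mem_bdry.2 ⟨hv.1, z, hzn, ?_⟩, hv.2⟩
    rcases hz with rfl | hz
    · exact absurd hv.1 hzn
    · exact hz
  · by_contra hcon
    have key : Cn (T ∩ box n) u v := by
      refine h.ind (fun a => Cn (T ∩ box n) u a) (Cn.refl ⟨h.left, hu⟩) ?_
      intro a b _ ih hab hb
      refine ih.tail hab ⟨hb, ?_⟩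
      by_contra hbn
      exact hcon ⟨a, mem_bdry.2 ⟨ih.right.2, b, hbn, hab⟩, ih⟩
    exact hv ⟨key.right.2, key⟩

theorem pi1n_mono {μ : Measure (Site → ℝ)} (hμ : IsUniformCoupling μ) {m n : ℝ} (hm : 1 ≤ m)
    (h : m ≤ n) : pi1n μ n ≤ pi1n μ m := by
  rw [pi1n_eq, pi1n_eq]
  refine Pr_mono hμ ?_
  rintro S ⟨u, v, hu, hv, hc⟩
  obtain ⟨hv, z, hz, hvz⟩ := mem_bdry.1 hv
  obtain ⟨a, ha, hca⟩ := arm_of (near_box hu hm) hc (Or.inr hvz) (fun hh => hz (box_mono h hh))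
  exact ⟨u, a, hu, ha, hca.mono (fun w hw => ⟨hw.1.1, hw.2⟩)⟩

/-- Sites next to the outside of a box are far. -/
theorem bdry_far {n : ℝ} {v : Site} (h : v ∈ innerBdry (box n)) {k : ℤ}
    (hk : (k : ℝ) ≤ 2 / 3 * n) : ¬ (-k < v.1 ∧ v.1 < k ∧ -k < v.2 ∧ v.2 < k) := by
  rintro ⟨h1, h2, h3, h4⟩
  obtain ⟨_, z, hz, hvz⟩ := mem_bdry.1 h
  have hb := hvz.bounds
  refine hz (bd_box ?_ ?_)
  · rw [abs_le]
    have a1 : (z.1 : ℝ) ≤ k := by exact_mod_cast (by omega : z.1 ≤ k)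
    have a2 : (-k : ℝ) ≤ z.1 := by exact_mod_cast (by omega : -k ≤ z.1)
    constructor <;> linarith
  · rw [abs_le]
    have a1 : (z.2 : ℝ) ≤ k := by exact_mod_cast (by omega : z.2 ≤ k)
    have a2 : (-k : ℝ) ≤ z.2 := by exact_mod_cast (by omega : -k ≤ z.2)
    constructor <;> linarith

theorem pi1n_U {μ : Measure (Site → ℝ)} (hμ : IsUniformCoupling μ) :
    ∃ δ : ℝ, 0 < δ ∧ δ < 1 ∧ ∀ n : ℝ, 1 ≤ n → pi1n μ (15 * n) ≤ (1 - δ) * pi1n μ n := by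
  obtain ⟨δ, hδ, h⟩ := Circ_prob hμ
  refine ⟨min δ (1 / 2), by positivity, lt_of_le_of_lt (min_le_right _ _) (by norm_num), ?_⟩
  intro n hn
  set r : ℤ := ⌈2 * n⌉ with hr
  have hr1 : 2 * n ≤ r := Int.le_ceil _
  have hr2 : (r : ℝ) < 2 * n + 1 := Int.ceil_lt_add_one _
  have hr3 : 1 ≤ r := by
    have : (1 : ℝ) ≤ r := by linarith
    exact_mod_cast this
  obtain ⟨Λ, hΛ, hΛ'⟩ := Circ_dep (r := r) (by omega)
  have e1 : Pr μ (fun S => ¬ Circ r Sᶜ) = 1 - Pr μ (Circ r) := by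
    have hd : DepOn Λ (fun S => Circ r Sᶜ) := by
      intro S
      show Circ r Sᶜ ↔ Circ r (S ∩ ↑Λ)ᶜ
      rw [hΛ Sᶜ, hΛ (S ∩ ↑Λ)ᶜ]
      have : Sᶜ ∩ (Λ : Set Site) = (S ∩ ↑Λ)ᶜ ∩ ↑Λ := by ext v; simp; tauto
      rw [this]
    rw [Pr_not hμ hd, Pr_flip hμ hΛ]
  have hd : DepOn Λ (fun S => ¬ Circ r Sᶜ) := by
    intro S
    show ¬ Circ r Sᶜ ↔ ¬ Circ r (S ∩ ↑Λ)ᶜ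
    rw [hΛ Sᶜ, hΛ (S ∩ ↑Λ)ᶜ]
    have : Sᶜ ∩ (Λ : Set Site) = (S ∩ ↑Λ)ᶜ ∩ ↑Λ := by ext v; simp; tauto
    rw [this]
  have e2 := Pr_indep hμ (Cx_dep (box_finite n) Near (innerBdry (box n))) hd (by
    rw [Finset.disjoint_left]
    intro v hv hv'
    refine hΛ' v hv' ?_
    obtain ⟨h1, h2⟩ := box_bd ((Set.Finite.mem_toFinset _).1 hv)
    rw [abs_le] at h1 h2
    refine ⟨?_, ?_, ?_, ?_⟩ <;> (rw [← Int.cast_lt (R := ℝ)]; push_cast; linarith))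
  have e3 : Pr μ (Arm (15 * n)) ≤ Pr μ (fun S => Arm n S ∧ ¬ Circ r Sᶜ) := by
    refine Pr_mono hμ ?_
    rintro S ⟨u, v, hu, hv, hc⟩
    constructor
    · obtain ⟨hv, z, hz, hvz⟩ := mem_bdry.1 hv
      obtain ⟨a, ha, hca⟩ := arm_of (near_box hu hn) hc (Or.inr hvz)
        (fun hh => hz (box_mono (by linarith) hh))
      exact ⟨u, a, hu, ha, hca.mono (fun w hw => ⟨hw.1.1, hw.2⟩)⟩
    · intro hC
      obtain ⟨z, hz⟩ := Circ_block hr3 hC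
      obtain ⟨w, h1, h2⟩ := hz _ u v hc (by
        have := near_bd hu
        rw [mem_Rect]; omega) (by
        have := bdry_far hv (k := 3 * r) (by push_cast; linarith)
        intro hh
        apply this
        omega)
      exact h2.right.1 h1.right.1
  rw [pi1n_eq, pi1n_eq]
  unfold Arm at *
  refine e3.trans (e2.le.trans ?_)
  rw [e1, mul_comm]
  refine mul_le_mul_of_nonneg_right ?_ (Pr_nonneg _)
  have := h r hr3
  have := min_le_left δ (1 / 2)
  linarith

/-- Arm from a small rhombus. -/
theorem Arm2_prob {μ : Measure (Site → ℝ)} (hμ : IsUniformCoupling μ) {n : ℝ} (hn : 1 ≤ n)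
    {r : ℤ} (hr : 0 ≤ r) (hrn : (r : ℝ) ≤ n / 3) :
    ((r : ℝ) + 1) / (24 * n) ≤ Pr μ (Cx (box n) (Rect (-r) r (-r) r) (innerBdry (box n))) := by
  set M : ℤ := ⌈2 * n⌉ with hM
  have hM1 : 2 * n ≤ M := Int.le_ceil _
  have hM2 : (M : ℝ) < 2 * n + 1 := Int.ceil_lt_add_one _
  have hM3 : 1 ≤ M := by
    have : (1 : ℝ) ≤ M := by linarith
    exact_mod_cast this
  set s : ℤ := r + 1 with hs
  set q := Pr μ (Cx (box n) (Rect (-r) r (-r) r) (innerBdry (box n))) with hq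
  have hj : ∀ j : ℤ, Pr μ (Cx (Rect (-M) M (-M) M) {v | v.1 = 0 ∧ j * s ≤ v.2 ∧ v.2 ≤ j * s + r}
      {v | v.1 = M}) ≤ q := by
    intro j
    have h1 := Cx_map hμ (Rect_finite (-M) M (-M) M) (a := {v | v.1 = 0 ∧ j * s ≤ v.2 ∧ v.2 ≤ j * s + r})
      (b := {v | v.1 = M}) (trl 0 (-(j * s))) (trl_HA _ _)
      (R' := Rect (-M) M (-M - j * s) (M - j * s)) (a' := {v | v.1 = 0 ∧ 0 ≤ v.2 ∧ v.2 ≤ r})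
      (b' := {v | v.1 = M}) (by
        intro v hv
        simp only [mem_Rect, trl, Equiv.coe_fn_mk] at *
        omega) (by
        intro v hv _
        simp only [trl, Equiv.coe_fn_mk, Set.mem_ofPred_eq] at *
        omega) (by
        intro v hv _
        simp only [trl, Equiv.coe_fn_mk, Set.mem_ofPred_eq] at *
        omega)
    refine h1.trans (Pr_mono hμ ?_)
    rintro S ⟨u, v, hu, hv, hc⟩
    simp only [Set.mem_ofPred_eq] at hu hv
    obtain ⟨a, ha, hca⟩ := arm_of (n := n) (z := v) (bd_box (by rw [hu.1]; simp; linarith) (by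
      have a1 : (u.2 : ℝ) ≤ r := by exact_mod_cast hu.2.2
      have a2 : (0 : ℝ) ≤ u.2 := by exact_mod_cast hu.2.1
      rw [abs_le]; constructor <;> linarith)) hc (Or.inl rfl) (by
      intro hh
      have := (box_bd hh).1
      rw [hv, abs_le] at this
      linarith)
    refine ⟨u, a, ?_, ha, hca.mono (fun w hw => ⟨hw.1.1, hw.2⟩)⟩
    rw [mem_Rect]; omega
  set I : Finset ℤ := Finset.Icc (-(M / s) - 1) (M / s) with hI
  have e1 : Pr μ (HX (-M) M (-M) M) ≤ Pr μ (fun S => ∃ j ∈ I,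
      Cx (Rect (-M) M (-M) M) {v | v.1 = 0 ∧ j * s ≤ v.2 ∧ v.2 ≤ j * s + r} {v | v.1 = M} S) := by
    refine Pr_mono hμ ?_
    rintro S ⟨u, v, hu, hv, hc⟩
    simp only [Set.mem_ofPred_eq] at hu hv
    obtain ⟨p, p', e1, e2, hP⟩ := hc.strip (fun v => v.1) (fun a b h => h.bounds.1)
      (a := 0) (b := M) (by omega) (by omega) (by omega)
    have hp := mem_Rect.1 hP.left.1.2
    have d1 := Int.emod_add_mul_ediv p.2 s
    have d2 := Int.emod_nonneg p.2 (show s ≠ 0 by omega)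
    have d3 := Int.emod_lt_of_pos p.2 (show 0 < s by omega)
    refine ⟨p.2 / s, ?_, p, p', ⟨e1, ?_, ?_⟩, e2, hP.mono (fun w hw => hw.1)⟩
    · rw [hI, Finset.mem_Icc]
      constructor
      · rw [Int.le_ediv_iff_mul_le (by omega)]
        have d4 := Int.emod_add_mul_ediv M s
        have d5 := Int.emod_lt_of_pos M (show 0 < s by omega)
        have : (-(M / s) - 1) * s = - (s * (M / s)) - s := by ring
        omega
      · exact Int.ediv_le_ediv (by omega) (by omega)
    · rw [mul_comm]; omega
    · rw [mul_comm]; omega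
  have e2 := Pr_exists hμ I (fun j => Cx (Rect (-M) M (-M) M)
    {v | v.1 = 0 ∧ j * s ≤ v.2 ∧ v.2 ≤ j * s + r} {v | v.1 = M})
  have e3 := Finset.sum_le_card_nsmul I (fun j => Pr μ (Cx (Rect (-M) M (-M) M)
    {v | v.1 = 0 ∧ j * s ≤ v.2 ∧ v.2 ≤ j * s + r} {v | v.1 = M})) q (fun j _ => hj j)
  have e4 := HX_sq hμ (x0 := -M) (x1 := M) (y0 := -M) (y1 := M) (by omega) rfl
  have e5 : 1 / 2 ≤ (I.card : ℝ) * q := by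
    rw [nsmul_eq_mul] at e3
    linarith
  have sp : (0 : ℝ) < r + 1 := by
    have : (0 : ℝ) ≤ r := by exact_mod_cast hr
    linarith
  have e6 : (I.card : ℝ) * (r + 1) ≤ 12 * n := by
    have c1 : (I.card : ℤ) = 2 * (M / s) + 2 := by
      have : 0 ≤ M / s := Int.ediv_nonneg (by omega) (by omega)
      rw [hI, Int.card_Icc]; omega
    have c2 : (I.card : ℤ) * s ≤ 2 * M + 2 * s := by
      rw [c1]
      have := Int.ediv_mul_le M (show s ≠ 0 by omega)
      have : (2 * (M / s) + 2) * s = 2 * (M / s * s) + 2 * s := by ring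
      omega
    have c3 : ((I.card : ℝ)) * (r + 1) ≤ 2 * M + 2 * (r + 1) := by
      have : (((I.card : ℤ) * s : ℤ) : ℝ) ≤ ((2 * M + 2 * s : ℤ) : ℝ) := by exact_mod_cast c2
      rw [hs] at this
      push_cast at this
      exact this
    linarith
  have q0 : 0 ≤ q := Pr_nonneg _
  rw [div_le_iff₀ (by linarith)]
  nlinarith

theorem pi1n_low {μ : Measure (Site → ℝ)} (hμ : IsUniformCoupling μ) {n : ℝ} (hn : 1 ≤ n) :
    1 / (24 * n) ≤ pi1n μ n := by
  have h := Arm2_prob hμ hn (r := 0) le_rfl (by simp; linarith)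
  rw [pi1n_eq]
  refine le_trans ?_ (h.trans (Pr_mono hμ ?_))
  · simp
  · rintro S ⟨u, v, hu, hv, hc⟩
    have : u = 0 := by
      rw [mem_Rect] at hu
      exact Prod.ext (by simp; omega) (by simp; omega)
    exact ⟨u, v, this ▸ zero_near, hv, hc⟩

theorem pi1n_L {μ : Measure (Site → ℝ)} (hμ : IsUniformCoupling μ) :
    ∃ C : ℝ, 0 < C ∧ ∀ m n : ℝ, 1 ≤ m → m ≤ n → pi1n μ m * m ≤ C * n * pi1n μ n := by
  obtain ⟨δ, hδ, h⟩ := Circ_prob hμ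
  refine ⟨216 / δ + 240, by positivity, ?_⟩
  intro m n hm hmn
  have pn : 0 ≤ pi1n μ n := by rw [pi1n_eq]; exact Pr_nonneg _
  have pm : 0 ≤ pi1n μ m := by rw [pi1n_eq]; exact Pr_nonneg _
  by_cases hm10 : m < 10
  · have h1 := pi1n_low hμ (hm.trans hmn)
    rw [div_le_iff₀ (by linarith)] at h1
    have h2 : pi1n μ m ≤ 1 := by rw [pi1n_eq]; exact Pr_le_one hμ _
    have h3 : 0 ≤ 216 / δ * n * pi1n μ n := by
      have : 0 ≤ n := by linarith
      positivity
    nlinarith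
  · push Not at hm10
    set r : ℤ := ⌊m / 9⌋ with hr
    have hr1 : (r : ℝ) ≤ m / 9 := Int.floor_le _
    have hr2 : m / 9 < r + 1 := Int.lt_floor_add_one _
    have hr3 : 1 ≤ r := by rw [hr, Int.le_floor]; push_cast; linarith
    have a1 := Arm2_prob hμ (hm.trans hmn) (r := r) (by omega) (by linarith)
    have a2 : m / (216 * n) ≤ Pr μ (Cx (box n) (Rect (-r) r (-r) r) (innerBdry (box n))) := by
      refine le_trans ?_ a1
      rw [div_le_div_iff₀ (by linarith) (by linarith)]
      nlinarith
    have a3 := fkg3 hμ (Cx_inc (box_finite m) Near (innerBdry (box m))) (Circ_inc r)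
      (Cx_inc (box_finite n) (Rect (-r) r (-r) r) (innerBdry (box n))) hδ.le
      (by have : 0 ≤ n := by linarith
          positivity : 0 ≤ m / (216 * n)) le_rfl (h r hr3) a2
    have a4 : pi1n μ m * δ * (m / (216 * n)) ≤ pi1n μ n := by
      rw [pi1n_eq, pi1n_eq]
      refine a3.trans (Pr_mono hμ ?_)
      rintro S ⟨⟨⟨u, v, hu, hv, hc⟩, hC⟩, u', v', hu', hv', hc'⟩
      obtain ⟨z, hz⟩ := Circ_block hr3 hC
      obtain ⟨w, b1, b2⟩ := hz _ u v hc (by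
        have := near_bd hu
        rw [mem_Rect]; omega) (by
        have := bdry_far hv (k := 3 * r) (by push_cast; linarith)
        intro hh
        apply this
        omega)
      obtain ⟨w', b1', b2'⟩ := hz _ u' v' hc' hu' (by
        have := bdry_far hv' (k := 3 * r) (by push_cast; linarith)
        intro hh
        apply this
        omega)
      have s1 : S ∩ box m ⊆ S ∩ box n := fun w hw => ⟨hw.1, box_mono hmn hw.2⟩
      have s2 : S ∩ Rect (-3 * r) (3 * r) (-3 * r) (3 * r) ⊆ S ∩ box n := by
        rintro w ⟨h1, h2⟩
        refine ⟨h1, ?_⟩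
        rw [mem_Rect] at h2
        obtain ⟨c1, c2, c3, c4⟩ := h2
        rw [← Int.cast_le (R := ℝ)] at c1 c2 c3 c4
        push_cast at c1 c2 c3 c4
        refine bd_box ?_ ?_ <;> rw [abs_le] <;> constructor <;> linarith
      exact ⟨u, v', hu, hv', (b1.mono s1).trans ((b2.mono s2).symm.trans ((b2'.mono s2).trans
        (b1'.symm.trans hc')))⟩
    have hn0 : 0 < n := by linarith
    have a5 : pi1n μ m * m ≤ 216 / δ * n * pi1n μ n := by
      have e : pi1n μ m * m = 216 / δ * n * (pi1n μ m * δ * (m / (216 * n))) := by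
        field_simp
      rw [e]
      exact mul_le_mul_of_nonneg_left a4 (by positivity)
    have : 0 ≤ 240 * n * pi1n μ n := by positivity
    linarith


/-! ### Conclusion -/

theorem psi_key {μ : Measure (Site → ℝ)} (hμ : IsUniformCoupling μ) {a : ℝ} (ha : 0 < a) :
    ∃ c : ℝ, 0 < c ∧ ∀ N : ℕ, 1 ≤ N → ∀ K : ℝ, 0 < K → (N : ℝ) < a * K ^ 2 →
      K ≤ mInfty μ a N → ∀ K' : ℝ, (N : ℝ) ≤ a * pi1n μ K' * K ^ 2 →
        K' * mInfty μ a N ≤ c * K ^ 2 := by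
  obtain ⟨δ, hδ, hδ1, hU⟩ := pi1n_U hμ
  obtain ⟨C, hC, hL⟩ := pi1n_L hμ
  set p := pi1n μ with hp
  have p0 : ∀ n, 0 ≤ p n := fun n => by rw [hp, pi1n_eq]; exact Pr_nonneg _
  have p1 : ∀ n, p n ≤ 1 := fun n => by rw [hp, pi1n_eq]; exact Pr_le_one hμ _
  have pm : ∀ m n, 1 ≤ m → m ≤ n → p n ≤ p m := fun m n h1 h2 => pi1n_mono hμ h1 h2
  have pl : ∀ n, 1 ≤ n → 1 ≤ 24 * n * p n := fun n hn => by
    have := pi1n_low hμ hn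
    rw [div_le_iff₀ (by linarith)] at this
    rw [hp]; linarith
  set θ : ℝ := 1 - δ / 2 with hθ
  have θ0 : 0 < θ := by linarith
  have θ1 : θ < 1 := by linarith
  have θ2 : 1 - δ ≤ θ ^ 2 := by nlinarith
  obtain ⟨J, hJ⟩ := exists_pow_lt_of_lt_one (show 0 < θ ^ 2 / a by positivity)
    (show 1 - δ < 1 by linarith)
  have pJ : ∀ j : ℕ, p (15 ^ j) ≤ (1 - δ) ^ j := by
    intro j
    induction j with
    | zero => simpa using p1 1
    | succ j ih =>
      have := hU (15 ^ j) (one_le_pow₀ (by norm_num))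
      rw [pow_succ', pow_succ']
      exact this.trans (mul_le_mul_of_nonneg_left ih (by linarith))
  refine ⟨(24 + C + 15 + 15 ^ J * a) / θ, by positivity, ?_⟩
  intro N hN K hK hNK hKM K' hK'
  set M := mInfty μ a N with hM
  have M0 : 0 < M := hK.trans_le hKM
  have hN1 : (1 : ℝ) ≤ N := by exact_mod_cast hN
  obtain ⟨m, hmS, hm⟩ : ∃ m, a * p m * m ^ 2 ≤ (N : ℝ) ∧ θ * M < m := by
    have hne : ({m : ℝ | a * pi1n μ m * m ^ 2 ≤ (N : ℝ)}).Nonempty := ⟨0, by simp⟩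
    obtain ⟨m, h1, h2⟩ := exists_lt_of_lt_csSup hne (show θ * M < sSup _ by
      change θ * M < M
      nlinarith)
    exact ⟨m, h1, h2⟩
  have mpos : 0 < m := lt_trans (by positivity) hm
  have hMm : M < m / θ := by rw [lt_div_iff₀ θ0]; linarith
  have K2 : 0 < K ^ 2 := by positivity
  -- it suffices to bound `K' * m`
  have red : ∀ x : ℝ, 0 ≤ x → x ≤ 24 + C + 15 + 15 ^ J * a → K' * M ≤ x / θ * K ^ 2 →
      K' * M ≤ (24 + C + 15 + 15 ^ J * a) / θ * K ^ 2 := by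
    intro x _ hx h
    refine h.trans ?_
    gcongr
  have h15 : (0 : ℝ) < 15 ^ J := by positivity
  have haJ : 0 < 15 ^ J * a := by positivity
  have fin : ∀ x : ℝ, 0 ≤ x → x ≤ 24 + C + 15 + 15 ^ J * a → 0 ≤ K' → K' * m ≤ x * K ^ 2 →
      K' * M ≤ (24 + C + 15 + 15 ^ J * a) / θ * K ^ 2 := by
    intro x hx0 hx hk h
    refine red x hx0 hx ?_
    have h1 : K' * M ≤ K' * (m / θ) := mul_le_mul_of_nonneg_left hMm.le hk
    have h2 : K' * (m / θ) = K' * m / θ := by ring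
    have h3 : x / θ * K ^ 2 = x * K ^ 2 / θ := by ring
    rw [h3]
    rw [h2] at h1
    exact h1.trans (by gcongr)
  by_cases hk0 : K' < 0
  · have : K' * M ≤ 0 := by nlinarith
    exact this.trans (by positivity)
  push Not at hk0
  have hap : a * p m * m ^ 2 ≤ a * p K' * K ^ 2 := hmS.trans hK'
  have hpp : p m * m ^ 2 ≤ p K' * K ^ 2 := by
    have : a * (p m * m ^ 2) ≤ a * (p K' * K ^ 2) := by linarith
    exact le_of_mul_le_mul_left this ha
  have hpk : p m * m ^ 2 ≤ K ^ 2 := by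
    have := p1 K'
    nlinarith
  by_cases hm1 : 1 ≤ m
  · have pmpos : 0 < p m := by
      have := pl m hm1
      by_contra hc
      have h0 : p m = 0 := le_antisymm (not_lt.1 hc) (p0 m)
      rw [h0] at this
      norm_num at this
    rcases lt_or_ge K' 1 with hk1 | hk1
    · refine fin 24 (by norm_num) (by linarith) hk0 ?_
      have h1 := pl m hm1
      have h2 : m ≤ 24 * (p m * m ^ 2) := by nlinarith
      nlinarith
    · rcases le_or_gt K' m with hkm | hkm
      · refine fin C hC.le (by linarith) hk0 ?_
        have h1 := hL K' m hk1 hkm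
        have h2 : p m * m * (K' * m) ≤ p m * m * (C * K ^ 2) := by
          have e1 : p m * m ^ 2 * K' ≤ p K' * K ^ 2 * K' := mul_le_mul_of_nonneg_right hpp hk0
          have e2 : p K' * K' * K ^ 2 ≤ C * m * p m * K ^ 2 := mul_le_mul_of_nonneg_right h1 K2.le
          linarith
        exact le_of_mul_le_mul_left h2 (by positivity)
      · refine fin 15 (by norm_num) (by linarith) hk0 ?_
        have h1 := pm m K' hm1 hkm.le
        have h2 : m ^ 2 ≤ K ^ 2 := by
          have : p m * m ^ 2 ≤ p m * K ^ 2 := hpp.trans (mul_le_mul_of_nonneg_right h1 K2.le)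
          exact le_of_mul_le_mul_left this pmpos
        have h3 : K' < 15 * m := by
          by_contra hc
          push Not at hc
          have h4 := (pm (15 * m) K' (by linarith) hc).trans (hU m hm1)
          have h5 : p m * m ^ 2 ≤ p m * ((1 - δ) * K ^ 2) := by
            have := mul_le_mul_of_nonneg_right h4 K2.le
            linarith
          have h6 := le_of_mul_le_mul_left h5 pmpos
          have h7 : θ * K < m := lt_of_le_of_lt (mul_le_mul_of_nonneg_left hKM θ0.le) hm
          have h8 : (θ * K) ^ 2 < m ^ 2 := pow_lt_pow_left₀ h7 (by positivity) (by norm_num)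
          have h9 : (1 - δ) * K ^ 2 ≤ θ ^ 2 * K ^ 2 := mul_le_mul_of_nonneg_right θ2 K2.le
          rw [mul_pow] at h8
          linarith
        nlinarith
  · push Not at hm1
    have hK1 : 1 ≤ a * K ^ 2 := by linarith
    have h1 : K' < 15 ^ J := by
      by_contra hc
      push Not at hc
      have h2 := (pm (15 ^ J) K' (one_le_pow₀ (by norm_num)) hc).trans (pJ J)
      have h3 : θ * K < 1 := lt_trans (lt_of_le_of_lt (mul_le_mul_of_nonneg_left hKM θ0.le) hm) hm1
      have h4 : (θ * K) ^ 2 < 1 := by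
        have := mul_pos θ0 hK
        nlinarith
      have h5 : p K' < θ ^ 2 / a := lt_of_le_of_lt h2 hJ
      rw [lt_div_iff₀ ha] at h5
      have h6 : p K' * a * K ^ 2 ≤ θ ^ 2 * K ^ 2 := mul_le_mul_of_nonneg_right h5.le K2.le
      rw [mul_pow] at h4
      linarith
    refine fin (15 ^ J * a) haJ.le (by linarith) hk0 ?_
    have h2 : K' * m ≤ 15 ^ J * 1 := mul_le_mul h1.le hm1.le mpos.le h15.le
    have h3 : (15 : ℝ) ^ J * 1 ≤ 15 ^ J * (a * K ^ 2) := mul_le_mul_of_nonneg_left hK1 h15.le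
    linarith


/-- Lemma 5.1 (separation of scales below `m_∞`). -/
theorem psi_ratio_bound
    (μ : Measure (Site → ℝ)) (hμ : IsUniformCoupling μ) :
    ∀ a : ℝ, 0 < a → ∃ c η : ℝ, 0 < c ∧ 0 < η ∧
      ∀ N : ℕ, 1 ≤ N → ∀ K : ℝ, 0 < K → (N : ℝ) < a * K ^ 2 → K ≤ mInfty μ a N →
        psiN μ a N K / K ≤ c * (K / mInfty μ a N) ^ η := by
  intro a ha
  obtain ⟨c, hc, h⟩ := psi_key hμ ha
  refine ⟨c, 1, hc, one_pos, ?_⟩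
  intro N hN K hK hNK hKM
  have M0 : 0 < mInfty μ a N := hK.trans_le hKM
  have h1 : psiN μ a N K ≤ c * K ^ 2 / mInfty μ a N := by
    refine Real.sSup_le (fun K' hK' => ?_) (by positivity)
    rw [le_div_iff₀ M0]
    exact h N hN K hK hNK hKM K' hK'
  rw [Real.rpow_one, div_le_iff₀ hK]
  refine h1.trans (le_of_eq ?_)
  ring

end FrozenPercolation
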